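/- Let Γ be a metric graph of genus g and let D be a very special divisor on Γ. Then 2 ≤ deg(D) ≤ 2g − 4; in particular, a metric graph of genus g ≤ 2 carries no very special divisors. -/

import Mathlib

noncomputable section

/-- The star with `n` rays of radius `r` in the complex plane:
`{ z ∈ ℂ : z = t·e^{2πik/n}, t ∈ [0,r], k ∈ ℤ }`. -/
def starSet (n : ℕ) (r : ℝ) : Set ℂ :=
  {z | ∃ t ∈ Set.Icc (0 : ℝ) r, ∃ k : ℤ,
    z = (t : ℂ) * Complex.exp (2 * (Real.pi : ℂ) * Complex.I * (k : ℂ) / (n : ℂ))}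

/-- `P` has a neighbourhood isometric to a star with `n` rays of some radius `r > 0`,
with `P` corresponding to `0`. -/
def HasStarNbhd (Γ : Type*) [MetricSpace Γ] (P : Γ) (n : ℕ) : Prop :=
  ∃ r > (0 : ℝ), ∃ U ∈ nhds P, ∃ φ : Γ → ℂ,
    φ P = 0 ∧ φ '' U = starSet n r ∧
    ∀ x ∈ U, ∀ y ∈ U, dist (φ x) (φ y) = dist x y

/-- A metric graph: a compact connected metric space in which every point has a
neighbourhood isometric to a star with `n ≥ 1` rays. -/
def IsMetricGraph (Γ : Type*) [MetricSpace Γ] : Prop :=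
  CompactSpace Γ ∧ ConnectedSpace Γ ∧ ∀ P : Γ, ∃ n : ℕ, 1 ≤ n ∧ HasStarNbhd Γ P n

/-- The valence of a point: the number of rays of a star neighbourhood. -/
noncomputable def valence (Γ : Type*) [MetricSpace Γ] (P : Γ) : ℕ :=
  sInf {n : ℕ | 1 ≤ n ∧ HasStarNbhd Γ P n}

/-- A vertex is a point of valence different from `2`. -/
def IsVertex (Γ : Type*) [MetricSpace Γ] (P : Γ) : Prop := valence Γ P ≠ 2

/-- The genus of a metric graph: `#edges - #vertices + 1`, the edges being the connected
components of the complement of the vertex set. -/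
noncomputable def graphGenus (Γ : Type*) [MetricSpace Γ] : ℤ :=
  (Nat.card (ConnectedComponents {P : Γ // ¬ IsVertex Γ P}) : ℤ)
    - (Nat.card {P : Γ // IsVertex Γ P} : ℤ) + 1

/-- A divisor on `Γ` : a finitely supported formal `ℤ`-linear combination of points. -/
abbrev Divisor (Γ : Type*) : Type _ := Γ →₀ ℤ

/-- The degree of a divisor. -/
def divDeg {Γ : Type*} (D : Divisor Γ) : ℤ := D.sum fun _ n => n

/-- A divisor is effective if all its coefficients are nonnegative. -/
def Effective {Γ : Type*} (D : Divisor Γ) : Prop := ∀ P : Γ, 0 ≤ D P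

/-- An arc based at `P` : an isometric parametrization of a segment emanating from `P`. -/
def IsArcAt {Γ : Type*} [MetricSpace Γ] (P : Γ) (τ : ℝ → Γ) : Prop :=
  τ 0 = P ∧ ∃ a > (0 : ℝ), ∀ s ∈ Set.Icc (0 : ℝ) a, ∀ t ∈ Set.Icc (0 : ℝ) a,
    dist (τ s) (τ t) = |s - t|

/-- Two arcs are equivalent (define the same tangent direction) when they agree near `0`. -/
def ArcEquiv {Γ : Type*} (τ τ' : ℝ → Γ) : Prop :=
  ∃ ε > (0 : ℝ), ∀ t ∈ Set.Icc (0 : ℝ) ε, τ t = τ' t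

/-- `f` has (one-sided) slope `s` along the arc `τ`. -/
def HasSlopeAlong {Γ : Type*} (f : Γ → ℝ) (τ : ℝ → Γ) (s : ℤ) : Prop :=
  ∃ ε > (0 : ℝ), ∀ t ∈ Set.Icc (0 : ℝ) ε, f (τ t) = f (τ 0) + (s : ℝ) * t

/-- A rational function on a metric graph: continuous and piecewise affine with
integer slopes, i.e. having an integer slope along every arc. -/
def IsRational (Γ : Type*) [MetricSpace Γ] (f : Γ → ℝ) : Prop :=
  Continuous f ∧ ∀ (P : Γ) (τ : ℝ → Γ), IsArcAt P τ → ∃ s : ℤ, HasSlopeAlong f τ s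

/-- `div f` has coefficient `m` at `P`: the sum of the slopes of `f` in all tangent
directions emanating from `P` equals `m`. -/
def HasOrderAt (Γ : Type*) [MetricSpace Γ] (f : Γ → ℝ) (P : Γ) (m : ℤ) : Prop :=
  ∃ (n : ℕ) (τ : Fin n → ℝ → Γ) (s : Fin n → ℤ),
    (∀ i, IsArcAt P (τ i)) ∧
    Pairwise (fun i j => ¬ ArcEquiv (τ i) (τ j)) ∧
    (∀ σ : ℝ → Γ, IsArcAt P σ → ∃ i, ArcEquiv σ (τ i)) ∧
    (∀ i, HasSlopeAlong f (τ i) (s i)) ∧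
    m = ∑ i, s i

/-- Linear equivalence of divisors: `D₂ - D₁ = div f` for some rational function `f`. -/
def LinEquiv (Γ : Type*) [MetricSpace Γ] (D₁ D₂ : Divisor Γ) : Prop :=
  ∃ f : Γ → ℝ, IsRational Γ f ∧ ∀ P : Γ, HasOrderAt Γ f P (D₂ P - D₁ P)

/-- `D` is linearly equivalent to an effective divisor. -/
def EquivEffective (Γ : Type*) [MetricSpace Γ] (D : Divisor Γ) : Prop :=
  ∃ D' : Divisor Γ, Effective D' ∧ LinEquiv Γ D D'

/-- For every effective divisor `E` of degree `r`, `D - E` is linearly equivalent to an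
effective divisor. -/
def RankGE (Γ : Type*) [MetricSpace Γ] (D : Divisor Γ) (r : ℕ) : Prop :=
  ∀ E : Divisor Γ, Effective E → divDeg E = (r : ℤ) → EquivEffective Γ (D - E)

/-- The rank of a divisor: `-1` if `D` is not equivalent to an effective divisor, and
otherwise the largest `r ≥ 0` such that `D - E` is equivalent to an effective divisor
for every effective `E` of degree `r`. -/
noncomputable def divRank (Γ : Type*) [MetricSpace Γ] (D : Divisor Γ) : ℤ :=
  sSup (insert (-1) {n : ℤ | ∃ r : ℕ, n = (r : ℤ) ∧ RankGE Γ D r})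

/-- The arc `τ` immediately leaves the set `X`. -/
def ArcLeaves {Γ : Type*} (X : Set Γ) (τ : ℝ → Γ) : Prop :=
  ∃ ε > (0 : ℝ), ∀ t ∈ Set.Ioc (0 : ℝ) ε, τ t ∉ X

/-- `P` is a non-saturated boundary point of `X` with respect to `D` : the number of
tangent directions at `P` leaving `X` is strictly greater than `D P`. -/
def NonSaturated (Γ : Type*) [MetricSpace Γ] (D : Divisor Γ) (X : Set Γ) (P : Γ) : Prop :=
  P ∈ frontier X ∧ ∃ (n : ℕ) (τ : Fin n → ℝ → Γ),
    (∀ i, IsArcAt P (τ i)) ∧ (∀ i, ArcLeaves X (τ i)) ∧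
    Pairwise (fun i j => ¬ ArcEquiv (τ i) (τ j)) ∧ D P < (n : ℤ)

/-- `D` is `P₀`-reduced. -/
def IsReducedDivisor (Γ : Type*) [MetricSpace Γ] (D : Divisor Γ) (P₀ : Γ) : Prop :=
  (∀ P : Γ, P ≠ P₀ → 0 ≤ D P) ∧
  ∀ X : Set Γ, IsClosed X → X.Nonempty → P₀ ∉ X → ∃ P, NonSaturated Γ D X P

/-- The restriction of a divisor on `Γ` to a divisor on a subset `S` (with the induced
metric); divisors supported on `S` are identified with divisors on `S` this way. -/
noncomputable def DivRestrict {Γ : Type*} (S : Set Γ) (D : Divisor Γ) : Divisor ↥S :=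
  Finsupp.comapDomain Subtype.val D Subtype.coe_injective.injOn

/-- Linear equivalence computed on the subgraph `S` of `Γ`. -/
def LinEquivOn {Γ : Type*} [MetricSpace Γ] (S : Set Γ) (D₁ D₂ : Divisor Γ) : Prop :=
  LinEquiv ↥S (DivRestrict S D₁) (DivRestrict S D₂)

/-- The rank computed on the subgraph `S` of `Γ`. -/
noncomputable def divRankOn {Γ : Type*} [MetricSpace Γ] (S : Set Γ) (D : Divisor Γ) : ℤ :=
  divRank ↥S (DivRestrict S D)

/-- A free divisor: effective, of rank at least one, and removing any point decreases
the rank. -/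
def IsFreeDivisor (Γ : Type*) [MetricSpace Γ] (D : Divisor Γ) : Prop :=
  Effective D ∧ 1 ≤ divRank Γ D ∧
  ∀ P : Γ, divRank Γ (D - Finsupp.single P 1) < divRank Γ D

/-- The canonical divisor `K_Γ = Σ_P (val(P) - 2)·P`. -/
def IsCanonical (Γ : Type*) [MetricSpace Γ] (K : Divisor Γ) : Prop :=
  ∀ P : Γ, K P = (valence Γ P : ℤ) - 2

/-- A very special divisor: effective with `rk(D) > 0` and `rk(K_Γ - D) > 0`. -/
def VerySpecial (Γ : Type*) [MetricSpace Γ] (D : Divisor Γ) : Prop :=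
  Effective D ∧ 0 < divRank Γ D ∧
  ∃ K : Divisor Γ, IsCanonical Γ K ∧ 0 < divRank Γ (K - D)

/-- `φ` is an `L`-periodic locally isometric parametrization of the circle `S ⊆ Γ`
of circumference `L`. -/
def CircleParam {Γ : Type*} [MetricSpace Γ] (S : Set Γ) (L : ℝ) (φ : ℝ → Γ) : Prop :=
  0 < L ∧ (∀ t : ℝ, φ (t + L) = φ t) ∧ Set.range φ = S ∧
  ∀ s t : ℝ, |s - t| ≤ L / 2 → dist (φ s) (φ t) = |s - t|

/-- `S` is a metric circle inside `Γ`. -/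
def IsCircleSet {Γ : Type*} [MetricSpace Γ] (S : Set Γ) : Prop :=
  ∃ (L : ℝ) (φ : ℝ → Γ), CircleParam S L φ

end

/-! ### Tangent directions -/

section Arcs

variable {Γ : Type*}

theorem ArcEquiv.symm {τ τ' : ℝ → Γ} (h : ArcEquiv τ τ') : ArcEquiv τ' τ :=
  let ⟨ε, hε, h⟩ := h
  ⟨ε, hε, fun t ht => (h t ht).symm⟩

theorem ArcEquiv.trans {τ τ' τ'' : ℝ → Γ} (h : ArcEquiv τ τ') (h' : ArcEquiv τ' τ'') :
    ArcEquiv τ τ'' := by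
  obtain ⟨ε, hε, h⟩ := h
  obtain ⟨ε', hε', h'⟩ := h'
  refine ⟨min ε ε', lt_min hε hε', fun t ht => ?_⟩
  rw [h t ⟨ht.1, ht.2.trans (min_le_left _ _)⟩, h' t ⟨ht.1, ht.2.trans (min_le_right _ _)⟩]

theorem HasSlopeAlong.congr {f : Γ → ℝ} {τ τ' : ℝ → Γ} {s : ℤ} (h : HasSlopeAlong f τ s)
    (e : ArcEquiv τ τ') : HasSlopeAlong f τ' s := by
  obtain ⟨ε, hε, h⟩ := h
  obtain ⟨ε', hε', e⟩ := e
  refine ⟨min ε ε', lt_min hε hε', fun t ht => ?_⟩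
  rw [← e t ⟨ht.1, ht.2.trans (min_le_right _ _)⟩, ← e 0 ⟨le_rfl, hε'.le⟩,
    h t ⟨ht.1, ht.2.trans (min_le_left _ _)⟩]

theorem HasSlopeAlong.unique {f : Γ → ℝ} {τ : ℝ → Γ} {s s' : ℤ} (h : HasSlopeAlong f τ s)
    (h' : HasSlopeAlong f τ s') : s = s' := by
  obtain ⟨ε, hε, h⟩ := h
  obtain ⟨ε', hε', h'⟩ := h'
  have hm : 0 < min ε ε' := lt_min hε hε'
  have h1 := h (min ε ε') ⟨hm.le, min_le_left _ _⟩
  have h2 := h' (min ε ε') ⟨hm.le, min_le_right _ _⟩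
  have h3 : (s : ℝ) * min ε ε' = s' * min ε ε' := by linarith
  exact_mod_cast mul_right_cancel₀ hm.ne' h3

variable [MetricSpace Γ]

/-- A family of arcs at `P` representing every tangent direction exactly once. -/
structure IsArcSystem (P : Γ) {ι : Type*} (τ : ι → ℝ → Γ) : Prop where
  arc : ∀ i, IsArcAt P (τ i)
  inequiv : Pairwise fun i j => ¬ ArcEquiv (τ i) (τ j)
  exhaust : ∀ σ, IsArcAt P σ → ∃ i, ArcEquiv σ (τ i)

theorem IsArcSystem.eq_of_arcEquiv {P : Γ} {ι : Type*} {τ : ι → ℝ → Γ} (h : IsArcSystem P τ)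
    {i j : ι} (hij : ArcEquiv (τ i) (τ j)) : i = j := by
  by_contra hne
  exact h.inequiv hne hij

theorem IsArcSystem.exists_equiv {P : Γ} {ι κ : Type*} {τ : ι → ℝ → Γ} {σ : κ → ℝ → Γ}
    (hτ : IsArcSystem P τ) (hσ : IsArcSystem P σ) :
    ∃ e : ι ≃ κ, ∀ i, ArcEquiv (τ i) (σ (e i)) := by
  choose a ha using fun i => hσ.exhaust (τ i) (hτ.arc i)
  choose b hb using fun k => hτ.exhaust (σ k) (hσ.arc k)
  exact ⟨⟨a, b, fun i => (hτ.eq_of_arcEquiv ((ha i).trans (hb _))).symm,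
    fun k => (hσ.eq_of_arcEquiv ((hb k).trans (ha _))).symm⟩, ha⟩

/-- A family of pairwise inequivalent arcs of the right cardinality is complete. -/
theorem IsArcSystem.of_card_eq {P : Γ} {ι κ : Type*} [Fintype ι] [Fintype κ]
    {τ : ι → ℝ → Γ} {σ : κ → ℝ → Γ} (hτ : IsArcSystem P τ)
    (hcard : Fintype.card κ = Fintype.card ι) (harc : ∀ k, IsArcAt P (σ k))
    (hne : Pairwise fun i j => ¬ ArcEquiv (σ i) (σ j)) : IsArcSystem P σ := by
  refine ⟨harc, hne, fun ρ hρ => ?_⟩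
  choose b hb using fun k => hτ.exhaust (σ k) (harc k)
  have hinj : Function.Injective b := fun k l hkl => by
    by_contra h
    have := hb l
    rw [← hkl] at this
    exact hne h ((hb k).trans this.symm)
  have hbij := (Fintype.bijective_iff_injective_and_card b).2 ⟨hinj, hcard⟩
  obtain ⟨i, hi⟩ := hτ.exhaust ρ hρ
  obtain ⟨k, rfl⟩ := hbij.2 i
  exact ⟨k, hi.trans (hb k).symm⟩

/-- The order of `f` at `P` may be computed with any complete system of arcs. -/
theorem HasOrderAt.eq_sum {f : Γ → ℝ} {P : Γ} {m : ℤ} (h : HasOrderAt Γ f P m)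
    {ι : Type*} [Fintype ι] {τ : ι → ℝ → Γ} (hτ : IsArcSystem P τ) {s : ι → ℤ}
    (hs : ∀ i, HasSlopeAlong f (τ i) (s i)) : m = ∑ i, s i := by
  obtain ⟨n, σ, s', h1, h2, h3, h4, rfl⟩ := h
  obtain ⟨e, he⟩ := IsArcSystem.exists_equiv ⟨h1, h2, h3⟩ hτ
  exact Fintype.sum_equiv e _ _ fun i => ((h4 i).congr (he i)).unique (hs (e i))

/-- A star neighbourhood of `P` in polar coordinates: `n` isometric rays `σ i` of length `ρ`
which cover the ball of radius `ρ` and two of which never form a geodesic segment of length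
`|s - t|`. -/
structure IsLocalStar (P : Γ) {n : ℕ} (σ : Fin n → ℝ → Γ) (ρ : ℝ) : Prop where
  pos : 0 < ρ
  base : ∀ i, σ i 0 = P
  isom : ∀ i, ∀ s ∈ Set.Icc 0 ρ, ∀ t ∈ Set.Icc 0 ρ, dist (σ i s) (σ i t) = |s - t|
  cover : ∀ x ∈ Metric.ball P ρ, ∃ i, ∃ t ∈ Set.Ico 0 ρ, x = σ i t
  eq_of_dist : ∀ i j, ∀ s ∈ Set.Ioc 0 ρ, ∀ t ∈ Set.Ioc 0 ρ,
    dist (σ i s) (σ j t) = |s - t| → i = j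

theorem mem_starSet_of_fin {n : ℕ} {r t : ℝ} (ht : t ∈ Set.Icc 0 r) (k : ℕ) :
    (t : ℂ) * Complex.exp (2 * Real.pi * Complex.I / n) ^ k ∈ starSet n r := by
  refine ⟨t, ht, k, ?_⟩
  rw [← Complex.exp_nat_mul]
  congr 2
  push_cast
  ring

theorem exists_fin_of_mem_starSet {n : ℕ} (hn : 1 ≤ n) {r : ℝ} {z : ℂ} (hz : z ∈ starSet n r) :
    ∃ t ∈ Set.Icc 0 r, ∃ k : Fin n,
      z = (t : ℂ) * Complex.exp (2 * Real.pi * Complex.I / n) ^ (k : ℕ) := by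
  obtain ⟨t, ht, k, rfl⟩ := hz
  have hn0 : (n : ℤ) ≠ 0 := by omega
  have h0 : 0 ≤ k % n := Int.emod_nonneg _ hn0
  have h1 : k % n < n := Int.emod_lt_of_pos _ (by omega)
  refine ⟨t, ht, ⟨(k % n).toNat, by omega⟩, ?_⟩
  congr 1
  set ζ := Complex.exp (2 * Real.pi * Complex.I / n) with hζ
  have hprim : IsPrimitiveRoot ζ n := Complex.isPrimitiveRoot_exp n (by omega)
  have hζ0 : ζ ≠ 0 := Complex.exp_ne_zero _
  have h2 : Complex.exp (2 * Real.pi * Complex.I * k / n) = ζ ^ k := by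
    rw [hζ, ← Complex.exp_int_mul]
    congr 1
    ring
  rw [h2]
  conv_lhs => rw [← Int.mul_ediv_add_emod k n, zpow_add₀ hζ0, zpow_mul, zpow_natCast,
    hprim.pow_eq_one, one_zpow, one_mul]
  rw [← zpow_natCast, Int.toNat_of_nonneg h0]

theorem HasStarNbhd.exists_isLocalStar {P : Γ} {n : ℕ} (hn : 1 ≤ n) (h : HasStarNbhd Γ P n) :
    ∃ (σ : Fin n → ℝ → Γ) (ρ : ℝ), IsLocalStar P σ ρ := by
  classical
  obtain ⟨r, hr, U, hU, φ, hφP, hφU, hiso⟩ := h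
  set ζ := Complex.exp (2 * Real.pi * Complex.I / n) with hζ
  have hprim : IsPrimitiveRoot ζ n := Complex.isPrimitiveRoot_exp n (by omega)
  have hnorm : ∀ k : ℕ, ‖ζ ^ k‖ = 1 := fun k => by
    rw [norm_pow, hprim.norm'_eq_one (by omega), one_pow]
  have hPU : P ∈ U := mem_of_mem_nhds hU
  have hinj : ∀ x ∈ U, ∀ y ∈ U, φ x = φ y → x = y := fun x hx y hy hxy => by
    rw [← dist_eq_zero, ← hiso x hx y hy, hxy, dist_self]
  have hex : ∀ (k : Fin n) (t : ℝ), ∃ x : Γ, t ∈ Set.Icc 0 r →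
      x ∈ U ∧ φ x = (t : ℂ) * ζ ^ (k : ℕ) := fun k t => by
    by_cases ht : t ∈ Set.Icc 0 r
    · have := mem_starSet_of_fin (n := n) ht k
      rw [← hφU] at this
      obtain ⟨x, hx, hxe⟩ := this
      exact ⟨x, fun _ => ⟨hx, hxe⟩⟩
    · exact ⟨P, fun h => absurd h ht⟩
  choose σ hσ using hex
  obtain ⟨ε, hε, hball⟩ := Metric.mem_nhds_iff.1 hU
  have hdist : ∀ (i j : Fin n), ∀ s ∈ Set.Icc 0 r, ∀ t ∈ Set.Icc 0 r,
      dist (σ i s) (σ j t) = ‖(s : ℂ) * ζ ^ (i : ℕ) - t * ζ ^ (j : ℕ)‖ := fun i j s hs t ht => by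
    rw [← hiso _ (hσ i s hs).1 _ (hσ j t ht).1, (hσ i s hs).2, (hσ j t ht).2, dist_eq_norm]
  refine ⟨σ, min ε r, lt_min hε hr, fun i => ?_, fun i s hs t ht => ?_, fun x hx => ?_,
    fun i j s hs t ht hd => ?_⟩
  · have h0 := hσ i 0 ⟨le_rfl, hr.le⟩
    exact hinj _ h0.1 _ hPU (by rw [h0.2, hφP]; simp)
  · rw [hdist i i s ⟨hs.1, hs.2.trans (min_le_right _ _)⟩ t ⟨ht.1, ht.2.trans (min_le_right _ _)⟩,
      ← sub_mul, norm_mul, hnorm, mul_one, ← Complex.ofReal_sub, Complex.norm_real,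
      Real.norm_eq_abs]
  · have hx' : dist x P < min ε r := hx
    have hxU : x ∈ U := hball (lt_of_lt_of_le hx' (min_le_left _ _))
    have : φ x ∈ starSet n r := hφU ▸ ⟨x, hxU, rfl⟩
    obtain ⟨t, ht, k, hk⟩ := exists_fin_of_mem_starSet hn this
    have hxP : dist x P = t := by
      rw [← hiso x hxU P hPU, hφP, hk, dist_zero_right, norm_mul, hnorm, mul_one,
        Complex.norm_real, Real.norm_of_nonneg ht.1]
    exact ⟨k, t, ⟨ht.1, hxP ▸ hx'⟩, hinj _ hxU _ (hσ k t ht).1 (by rw [hk, (hσ k t ht).2])⟩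
  · rw [hdist i j s ⟨hs.1.le, hs.2.trans (min_le_right _ _)⟩ t
      ⟨ht.1.le, ht.2.trans (min_le_right _ _)⟩] at hd
    have hs' : ‖(s : ℂ) * ζ ^ (i : ℕ)‖ = s := by
      rw [norm_mul, hnorm, mul_one, Complex.norm_real, Real.norm_of_nonneg hs.1.le]
    have ht' : ‖(t : ℂ) * ζ ^ (j : ℕ)‖ = t := by
      rw [norm_mul, hnorm, mul_one, Complex.norm_real, Real.norm_of_nonneg ht.1.le]
    have hray : SameRay ℝ ((s : ℂ) * ζ ^ (i : ℕ)) ((t : ℂ) * ζ ^ (j : ℕ)) :=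
      sameRay_iff_norm_sub.2 (by rw [hd, hs', ht'])
    have h1 := hray.norm_smul_eq
    rw [hs', ht', Complex.real_smul, Complex.real_smul] at h1
    have hs0 : (s : ℂ) ≠ 0 := by exact_mod_cast hs.1.ne'
    have ht0 : (t : ℂ) ≠ 0 := by exact_mod_cast ht.1.ne'
    have h2 : ζ ^ (i : ℕ) = ζ ^ (j : ℕ) := by
      have h3 : (s : ℂ) * t * ζ ^ (i : ℕ) = s * t * ζ ^ (j : ℕ) := by linear_combination -h1
      exact mul_left_cancel₀ (mul_ne_zero hs0 ht0) h3
    exact Fin.ext (hprim.pow_inj i.2 j.2 h2)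

namespace IsLocalStar

variable {P : Γ} {n : ℕ} {σ : Fin n → ℝ → Γ} {ρ : ℝ}

theorem dist_base (h : IsLocalStar P σ ρ) (i : Fin n) {t : ℝ} (ht : t ∈ Set.Icc 0 ρ) :
    dist (σ i t) P = t := by
  rw [← h.base i, h.isom i t ht 0 ⟨le_rfl, h.pos.le⟩, sub_zero, abs_of_nonneg ht.1]

theorem isArcSystem (h : IsLocalStar P σ ρ) : IsArcSystem P σ := by
  refine ⟨fun i => ⟨h.base i, ρ, h.pos, h.isom i⟩, fun i j hij ⟨ε, hε, he⟩ => hij ?_,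
    fun τ ⟨hτ0, a, ha, hτ⟩ => ?_⟩
  · have hm : min ε ρ ∈ Set.Ioc 0 ρ := ⟨lt_min hε h.pos, min_le_right _ _⟩
    refine h.eq_of_dist i j _ hm _ hm ?_
    rw [he _ ⟨hm.1.le, min_le_left _ _⟩]
    simp
  · obtain ⟨b, hb0, hba, hbρ⟩ : ∃ b, 0 < b ∧ b ≤ a ∧ b < ρ :=
      ⟨min a (ρ / 2), lt_min ha (half_pos h.pos), min_le_left _ _,
        (min_le_right _ _).trans_lt (half_lt_self h.pos)⟩
    have key : ∀ t ∈ Set.Icc 0 b, ∃ i, τ t = σ i t := fun t ht => by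
      have hd : dist (τ t) P = t := by
        rw [← hτ0, hτ t ⟨ht.1, ht.2.trans hba⟩ 0 ⟨le_rfl, ha.le⟩, sub_zero, abs_of_nonneg ht.1]
      obtain ⟨i, s, hs, he⟩ := h.cover (τ t) (by rw [Metric.mem_ball, hd]; linarith [ht.2])
      have : s = t := by rw [← hd, he, h.dist_base i ⟨hs.1, hs.2.le⟩]
      exact ⟨i, this ▸ he⟩
    obtain ⟨i, hi⟩ := key b ⟨hb0.le, le_rfl⟩
    refine ⟨i, b, hb0, fun t ht => ?_⟩
    rcases ht.1.eq_or_lt with rfl | ht0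
    · rw [hτ0, h.base]
    obtain ⟨j, hj⟩ := key t ht
    have : j = i := h.eq_of_dist j i t ⟨ht0, ht.2.trans hbρ.le⟩ b ⟨hb0, hbρ.le⟩ (by
      rw [← hi, ← hj, hτ t ⟨ht.1, ht.2.trans hba⟩ b ⟨hb0.le, hba⟩])
    rw [hj, this]

theorem isOpen_ray (h : IsLocalStar P σ ρ) (i : Fin n) : IsOpen (σ i '' Set.Ioo 0 ρ) := by
  have hcont : ∀ j, ContinuousOn (σ j) (Set.Icc 0 ρ) := fun j =>
    (LipschitzOnWith.of_dist_le_mul (K := 1) fun s hs t ht => by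
      rw [h.isom j s hs t ht, NNReal.coe_one, one_mul, Real.dist_eq]).continuousOn
  have hK : IsClosed (⋃ j ∈ {j | j ≠ i}, σ j '' Set.Icc 0 ρ) :=
    (Set.toFinite _).isClosed_biUnion fun j _ =>
      (isCompact_Icc.image_of_continuousOn (hcont j)).isClosed
  have : σ i '' Set.Ioo 0 ρ = Metric.ball P ρ ∩ {P}ᶜ ∩ (⋃ j ∈ {j | j ≠ i}, σ j '' Set.Icc 0 ρ)ᶜ := by
    ext x
    simp only [Set.mem_image, Set.mem_inter_iff, Metric.mem_ball, Set.mem_compl_iff,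
      Set.mem_singleton_iff, Set.mem_iUnion, not_exists]
    constructor
    · rintro ⟨t, ht, rfl⟩
      have hd := h.dist_base i ⟨ht.1.le, ht.2.le⟩
      have hne : σ i t ≠ P := fun he => by
        rw [he, dist_self] at hd
        exact ht.1.ne hd
      refine ⟨⟨by rw [hd]; exact ht.2, hne⟩, fun j hj s hs => hj ?_⟩
      have hst : s = t := by rw [← h.dist_base j hs.1, hs.2, hd]
      subst hst
      exact h.eq_of_dist j i s ⟨ht.1, hs.1.2⟩ s ⟨ht.1, hs.1.2⟩ (by rw [hs.2]; simp)
    · rintro ⟨⟨hx, hxP⟩, hj⟩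
      obtain ⟨j, t, ht, rfl⟩ := h.cover x hx
      have hji : j = i := by
        by_contra hne
        exact hj j hne t ⟨⟨ht.1, ht.2.le⟩, rfl⟩
      subst hji
      refine ⟨t, ⟨ht.1.lt_of_ne ?_, ht.2⟩, rfl⟩
      rintro rfl
      exact hxP (h.base j)
  rw [this]
  exact (Metric.isOpen_ball.inter isOpen_compl_singleton).inter hK.isOpen_compl

end IsLocalStar

theorem valence_eq {P : Γ} {n : ℕ} (hn : 1 ≤ n) (h : HasStarNbhd Γ P n) : valence Γ P = n := by
  have : {m : ℕ | 1 ≤ m ∧ HasStarNbhd Γ P m} = {n} := by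
    ext m
    simp only [Set.mem_ofPred_eq, Set.mem_singleton_iff]
    constructor
    · rintro ⟨hm, hm'⟩
      obtain ⟨σ, ρ, hσ⟩ := h.exists_isLocalStar hn
      obtain ⟨σ', ρ', hσ'⟩ := hm'.exists_isLocalStar hm
      obtain ⟨e, -⟩ := hσ'.isArcSystem.exists_equiv hσ.isArcSystem
      exact Fin.equiv_iff_eq.1 ⟨e⟩
    · rintro rfl
      exact ⟨hn, h⟩
  rw [valence, this, csInf_singleton]

theorem IsMetricGraph.exists_isLocalStar (hΓ : IsMetricGraph Γ) (P : Γ) :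
    1 ≤ valence Γ P ∧
      ∃ (σ : Fin (valence Γ P) → ℝ → Γ) (ρ : ℝ), IsLocalStar P σ ρ := by
  obtain ⟨n, hn, h⟩ := hΓ.2.2 P
  rw [valence_eq hn h]
  exact ⟨hn, h.exists_isLocalStar hn⟩

theorem IsMetricGraph.valence_eq_card (hΓ : IsMetricGraph Γ) {P : Γ} {ι : Type*} [Fintype ι]
    {τ : ι → ℝ → Γ} (h : IsArcSystem P τ) : valence Γ P = Fintype.card ι := by
  obtain ⟨-, σ, ρ, hσ⟩ := hΓ.exists_isLocalStar P
  obtain ⟨e, -⟩ := hσ.isArcSystem.exists_equiv h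
  rw [← Fintype.card_congr e, Fintype.card_fin]

end Arcs

/-! ### Open arcs and edges -/

section Edges

variable {Γ : Type*} [MetricSpace Γ]

/-- An isometrically parametrized segment of length `ℓ` whose interior is open in `Γ`. -/
structure IsOpenArc (τ : ℝ → Γ) (ℓ : ℝ) : Prop where
  pos : 0 < ℓ
  isom : ∀ s ∈ Set.Icc 0 ℓ, ∀ t ∈ Set.Icc 0 ℓ, dist (τ s) (τ t) = |s - t|
  isOpen : IsOpen (τ '' Set.Ioo 0 ℓ)

namespace IsOpenArc

variable {τ : ℝ → Γ} {ℓ : ℝ}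

theorem dist_left (h : IsOpenArc τ ℓ) {t : ℝ} (ht : t ∈ Set.Icc 0 ℓ) : dist (τ t) (τ 0) = t := by
  rw [h.isom t ht 0 ⟨le_rfl, h.pos.le⟩, sub_zero, abs_of_nonneg ht.1]

theorem injOn (h : IsOpenArc τ ℓ) : Set.InjOn τ (Set.Icc 0 ℓ) := fun s hs t ht he => by
  rw [← h.dist_left hs, he, h.dist_left ht]

theorem continuousOn (h : IsOpenArc τ ℓ) : ContinuousOn τ (Set.Icc 0 ℓ) :=
  (LipschitzOnWith.of_dist_le_mul (K := 1) fun s hs t ht => by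
    rw [h.isom s hs t ht, NNReal.coe_one, one_mul, Real.dist_eq]).continuousOn

theorem reverse (h : IsOpenArc τ ℓ) : IsOpenArc (fun t => τ (ℓ - t)) ℓ := by
  refine ⟨h.pos, fun s hs t ht => ?_, ?_⟩
  · rw [h.isom _ ⟨by linarith [hs.2], by linarith [hs.1]⟩ _
      ⟨by linarith [ht.2], by linarith [ht.1]⟩, abs_sub_comm]
    congr 1
    ring
  · have : (fun t => τ (ℓ - t)) '' Set.Ioo 0 ℓ = τ '' Set.Ioo 0 ℓ := by
      rw [show (fun t => τ (ℓ - t)) = τ ∘ fun t => ℓ - t from rfl, Set.image_comp,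
        Set.image_const_sub_Ioo, sub_self, sub_zero]
    rw [this]
    exact h.isOpen

theorem isOpen_image_Ioo (h : IsOpenArc τ ℓ) {a b : ℝ} (ha : 0 ≤ a) (hb : b ≤ ℓ) :
    IsOpen (τ '' Set.Ioo a b) := by
  have : τ '' Set.Ioo a b = τ '' Set.Ioo 0 ℓ ∩ (fun x => dist x (τ 0)) ⁻¹' Set.Ioo a b := by
    ext x
    constructor
    · rintro ⟨t, ht, rfl⟩
      have ht' : t ∈ Set.Ioo 0 ℓ := ⟨ha.trans_lt ht.1, ht.2.trans_le hb⟩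
      refine ⟨⟨t, ht', rfl⟩, ?_⟩
      rw [Set.mem_preimage, h.dist_left (Set.Ioo_subset_Icc_self ht')]
      exact ht
    · rintro ⟨⟨t, ht, rfl⟩, hx⟩
      rw [Set.mem_preimage, h.dist_left (Set.Ioo_subset_Icc_self ht)] at hx
      exact ⟨t, hx, rfl⟩
  rw [this]
  exact h.isOpen.inter (isOpen_Ioo.preimage (by fun_prop))

theorem subarc (h : IsOpenArc τ ℓ) {a b : ℝ} (ha : 0 ≤ a) (hab : a < b) (hb : b ≤ ℓ) :
    IsOpenArc (fun t => τ (a + t)) (b - a) := by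
  refine ⟨sub_pos.2 hab, fun s hs t ht => ?_, ?_⟩
  · rw [h.isom _ ⟨by linarith [hs.1], by linarith [hs.2]⟩ _
      ⟨by linarith [ht.1], by linarith [ht.2]⟩]
    congr 1
    ring
  · rw [show (fun t => τ (a + t)) = τ ∘ fun t => a + t from rfl, Set.image_comp,
      Set.image_const_add_Ioo, add_zero, add_sub_cancel]
    exact h.isOpen_image_Ioo ha hb

theorem isArcAt (h : IsOpenArc τ ℓ) : IsArcAt (τ 0) τ := ⟨rfl, ℓ, h.pos, h.isom⟩

theorem starSet_two (r : ℝ) : starSet 2 r = Complex.ofReal '' Set.Icc (-r) r := by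
  ext z
  constructor
  · intro hz
    obtain ⟨t, ht, k, rfl⟩ := exists_fin_of_mem_starSet (by norm_num) hz
    have hζ : Complex.exp (2 * Real.pi * Complex.I / (2 : ℕ)) = -1 := by
      rw [← Complex.exp_pi_mul_I]
      congr 1
      push_cast
      ring
    rw [hζ]
    have := ht.1
    have := ht.2
    fin_cases k
    · exact ⟨t, ⟨by linarith, ht.2⟩, by simp⟩
    · exact ⟨-t, ⟨by linarith, by linarith⟩, by simp⟩
  · rintro ⟨t, ht, rfl⟩
    have hζ : Complex.exp (2 * Real.pi * Complex.I / (2 : ℕ)) = -1 := by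
      rw [← Complex.exp_pi_mul_I]
      congr 1
      push_cast
      ring
    rcases le_total 0 t with h0 | h0
    · have := mem_starSet_of_fin (n := 2) (r := r) ⟨h0, ht.2⟩ 0
      simpa using this
    · have := mem_starSet_of_fin (n := 2) (r := r) (t := -t) ⟨by linarith, by linarith [ht.1]⟩ 1
      rw [hζ] at this
      simpa using this

theorem hasStarNbhd_two (h : IsOpenArc τ ℓ) {t : ℝ} (ht : t ∈ Set.Ioo 0 ℓ) :
    HasStarNbhd Γ (τ t) 2 := by
  obtain ⟨r, hr, h1, h2⟩ : ∃ r > 0, 0 ≤ t - r ∧ t + r ≤ ℓ := by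
    refine ⟨min t (ℓ - t), lt_min ht.1 (sub_pos.2 ht.2), ?_, ?_⟩
    · linarith [min_le_left t (ℓ - t)]
    · linarith [min_le_right t (ℓ - t)]
  have hsub : ∀ s ∈ Set.Icc (t - r) (t + r), s ∈ Set.Icc 0 ℓ := fun s hs =>
    ⟨h1.trans hs.1, hs.2.trans h2⟩
  refine ⟨r, hr, τ '' Set.Icc (t - r) (t + r), ?_, fun x => ((dist x (τ 0) - t : ℝ) : ℂ), ?_, ?_, ?_⟩
  · exact Filter.mem_of_superset ((h.isOpen_image_Ioo h1 h2).mem_nhds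
      ⟨t, ⟨by linarith, by linarith⟩, rfl⟩) (Set.image_mono Set.Ioo_subset_Icc_self)
  · simp only [h.dist_left (Set.Ioo_subset_Icc_self ht), sub_self, Complex.ofReal_zero]
  · rw [starSet_two]
    ext z
    constructor
    · rintro ⟨_, ⟨s, hs, rfl⟩, rfl⟩
      refine ⟨s - t, ⟨by linarith [hs.1], by linarith [hs.2]⟩, ?_⟩
      simp only [h.dist_left (hsub s hs)]
    · rintro ⟨s, hs, rfl⟩
      have hs' : t + s ∈ Set.Icc (t - r) (t + r) := ⟨by linarith [hs.1], by linarith [hs.2]⟩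
      refine ⟨_, ⟨t + s, hs', rfl⟩, ?_⟩
      simp only [h.dist_left (hsub _ hs'), add_sub_cancel_left]
  · rintro _ ⟨s, hs, rfl⟩ _ ⟨s', hs', rfl⟩
    simp only [h.dist_left (hsub s hs), h.dist_left (hsub s' hs')]
    rw [h.isom _ (hsub s hs) _ (hsub s' hs'), dist_eq_norm, ← Complex.ofReal_sub,
      Complex.norm_real, Real.norm_eq_abs]
    congr 1
    ring

theorem forward (h : IsOpenArc τ ℓ) {t : ℝ} (ht : t ∈ Set.Ioo 0 ℓ) :
    IsArcAt (τ t) fun s => τ (t + s) := by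
  simpa using (h.subarc ht.1.le ht.2 le_rfl).isArcAt

theorem backward (h : IsOpenArc τ ℓ) {t : ℝ} (ht : t ∈ Set.Ioo 0 ℓ) :
    IsArcAt (τ t) fun s => τ (t - s) := by
  simpa using (h.subarc le_rfl ht.1 ht.2.le).reverse.isArcAt

/-- The two directions at an interior point of an open arc. -/
theorem isArcSystem (h : IsOpenArc τ ℓ) {t : ℝ} (ht : t ∈ Set.Ioo 0 ℓ) :
    IsArcSystem (τ t) fun b : Bool => if b then fun s => τ (t + s) else fun s => τ (t - s) := by
  have hne : ¬ ArcEquiv (fun s => τ (t + s)) (fun s => τ (t - s)) := by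
    rintro ⟨ε, hε, he⟩
    have hm : 0 < min ε (min t (ℓ - t)) := lt_min hε (lt_min ht.1 (sub_pos.2 ht.2))
    have h1 := he _ ⟨hm.le, min_le_left _ _⟩
    have h2 : min ε (min t (ℓ - t)) ≤ t := (min_le_right _ _).trans (min_le_left _ _)
    have h3 : min ε (min t (ℓ - t)) ≤ ℓ - t := (min_le_right _ _).trans (min_le_right _ _)
    have := h.injOn ⟨by linarith, by linarith⟩ ⟨by linarith, by linarith [ht.2]⟩ h1
    linarith
  obtain ⟨σ, ρ, hσ⟩ := (h.hasStarNbhd_two ht).exists_isLocalStar (by norm_num)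
  refine hσ.isArcSystem.of_card_eq (by simp) (fun b => ?_) fun b b' hb => ?_
  · cases b
    · exact h.backward ht
    · exact h.forward ht
  · cases b <;> cases b'
    · exact absurd rfl hb
    · exact fun h' => hne h'.symm
    · exact hne
    · exact absurd rfl hb

/-- A rational function without zeros and poles inside an open arc is affine there. -/
theorem affine (h : IsOpenArc τ ℓ) {f : Γ → ℝ} (hf : IsRational Γ f)
    (h0 : ∀ t ∈ Set.Ioo 0 ℓ, HasOrderAt Γ f (τ t) 0) {s : ℤ} (hs : HasSlopeAlong f τ s) :
    ∀ t ∈ Set.Icc 0 ℓ, f (τ t) = f (τ 0) + s * t := by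
  have hloc : ∀ t ∈ Set.Ioo 0 ℓ, ∃ m : ℤ, ∀ᶠ x in nhds t, f (τ x) = f (τ t) + m * (x - t) := by
    intro t ht
    obtain ⟨m, hm⟩ := hf.2 _ _ (h.forward ht)
    obtain ⟨m', hm'⟩ := hf.2 _ _ (h.backward ht)
    have hsum := (h0 t ht).eq_sum (h.isArcSystem ht) (s := fun b => if b then m else m')
      (fun b => by cases b <;> simpa)
    simp only [Fintype.sum_bool, if_true, Bool.false_eq_true, if_false] at hsum
    have hm'm : (m' : ℝ) = -m := by
      have : m' = -m := by omega
      exact_mod_cast this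
    obtain ⟨ε, hε, hm⟩ := hm
    obtain ⟨ε', hε', hm'⟩ := hm'
    refine ⟨m, ?_⟩
    filter_upwards [Icc_mem_nhds (show t - ε' < t by linarith) (show t < t + ε by linarith)]
      with x hx
    rcases le_total t x with hx' | hx'
    · have := hm (x - t) ⟨by linarith, by linarith [hx.2]⟩
      simpa using this
    · have := hm' (t - x) ⟨by linarith, by linarith [hx.1]⟩
      rw [hm'm] at this
      simp only [sub_sub_cancel, sub_zero] at this
      rw [this]
      ring
  set g : ℝ → ℝ := fun x => f (τ x) with hg
  have hderiv : ∀ t ∈ Set.Ioo 0 ℓ, ∃ m : ℤ, ∀ᶠ x in nhds t, HasDerivAt g m x := by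
    intro t ht
    obtain ⟨m, hm⟩ := hloc t ht
    refine ⟨m, hm.eventually_nhds.mono fun x hx => ?_⟩
    have h1 : HasDerivAt (fun y : ℝ => f (τ t) + m * (y - t)) m x := by
      simpa using ((((hasDerivAt_id x).sub_const t).const_mul (m : ℝ)).const_add (f (τ t)))
    exact h1.congr_of_eventuallyEq hx
  have hdd : ∀ t ∈ Set.Ioo 0 ℓ, HasDerivAt (deriv g) 0 t := by
    intro t ht
    obtain ⟨m, hm⟩ := hderiv t ht
    exact (hasDerivAt_const t (m : ℝ)).congr_of_eventuallyEq (hm.mono fun x hx => hx.deriv)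
  obtain ⟨c, hc⟩ : ∃ c, ∀ t ∈ Set.Ioo 0 ℓ, deriv g t = c :=
    isOpen_Ioo.exists_is_const_of_deriv_eq_zero isPreconnected_Ioo
      (fun t ht => (hdd t ht).differentiableAt.differentiableWithinAt)
      (fun t ht => (hdd t ht).deriv)
  have hgc : ∀ t ∈ Set.Ioo 0 ℓ, HasDerivAt (fun x => g x - c * x) 0 t := by
    intro t ht
    obtain ⟨m, hm⟩ := hderiv t ht
    have h1 : HasDerivAt g c t := by
      rw [← hc t ht]
      exact hm.self_of_nhds.differentiableAt.hasDerivAt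
    have h2 := h1.sub ((hasDerivAt_id t).const_mul c)
    rw [mul_one, sub_self] at h2
    exact h2
  obtain ⟨d, hd⟩ : ∃ d, ∀ t ∈ Set.Ioo 0 ℓ, g t - c * t = d :=
    isOpen_Ioo.exists_is_const_of_deriv_eq_zero isPreconnected_Ioo
      (fun t ht => (hgc t ht).differentiableAt.differentiableWithinAt)
      (fun t ht => (hgc t ht).deriv)
  have hcont : ContinuousOn g (Set.Icc 0 ℓ) := hf.1.comp_continuousOn h.continuousOn
  have hall : Set.EqOn g (fun t => d + c * t) (Set.Icc 0 ℓ) := by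
    have : Set.EqOn g (fun t => d + c * t) (Set.Ioo 0 ℓ) := fun t ht => by
      have := hd t ht
      simp only
      linarith
    exact this.of_subset_closure hcont (by fun_prop) Set.Ioo_subset_Icc_self
      (by rw [closure_Ioo h.pos.ne])
  obtain ⟨ε, hε, hs⟩ := hs
  have hm : 0 < min ε ℓ := lt_min hε h.pos
  have h1 := hs _ ⟨hm.le, min_le_left _ _⟩
  have h2 : g (min ε ℓ) = d + c * min ε ℓ := hall ⟨hm.le, min_le_right _ _⟩
  have h3 : g 0 = d + c * 0 := hall ⟨le_rfl, h.pos.le⟩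
  have h4 : (s : ℝ) = c := by
    have : (s : ℝ) * min ε ℓ = c * min ε ℓ := by simp only [hg] at h2 h3; linarith
    exact mul_right_cancel₀ hm.ne' this
  intro t ht
  have h5 : g t = d + c * t := hall ht
  simp only [hg] at h3 h5
  rw [h5, h3, h4]
  ring

end IsOpenArc

/-- An edge of the subdivision of `Γ` with vertex set `S`. -/
structure IsEdge (S : Set Γ) (τ : ℝ → Γ) (ℓ : ℝ) : Prop extends IsOpenArc τ ℓ where
  left_mem : τ 0 ∈ S
  right_mem : τ ℓ ∈ S
  notMem : ∀ t ∈ Set.Ioo 0 ℓ, τ t ∉ S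

/-- Between two marked points of an open arc, the unmarked points lie on edges. -/
theorem IsOpenArc.exists_isEdge {τ : ℝ → Γ} {ℓ : ℝ} (h : IsOpenArc τ ℓ) {S : Set Γ}
    (hS : S.Finite) (h0 : τ 0 ∈ S) (hℓ : τ ℓ ∈ S) {t : ℝ} (ht : t ∈ Set.Icc 0 ℓ)
    (htS : τ t ∉ S) : ∃ τ' ℓ', IsEdge S τ' ℓ' ∧ τ t ∈ τ' '' Set.Ioo 0 ℓ' := by
  set A : Set ℝ := {s ∈ Set.Icc 0 ℓ | τ s ∈ S} with hA
  have hAfin : A.Finite := by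
    refine Set.Finite.of_finite_image (hS.subset ?_) (h.injOn.mono fun s hs => hs.1)
    rintro _ ⟨s, hs, rfl⟩
    exact hs.2
  have ht0 : 0 < t := ht.1.lt_of_ne fun he => htS (he ▸ h0)
  have htℓ : t < ℓ := ht.2.lt_of_ne fun he => htS (he ▸ hℓ)
  obtain ⟨a, ⟨haA, hat⟩, hamax⟩ := Set.exists_max_image (A ∩ Set.Iio t) id (hAfin.inter_of_left _)
    ⟨0, ⟨⟨le_rfl, h.pos.le⟩, h0⟩, ht0⟩
  obtain ⟨b, ⟨hbA, hbt⟩, hbmin⟩ := Set.exists_min_image (A ∩ Set.Ioi t) id (hAfin.inter_of_left _)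
    ⟨ℓ, ⟨⟨h.pos.le, le_rfl⟩, hℓ⟩, htℓ⟩
  have hat : a < t := hat
  have hbt : t < b := hbt
  refine ⟨fun s => τ (a + s), b - a, ⟨h.subarc haA.1.1 (hat.trans hbt) hbA.1.2, ?_, ?_,
    fun s hs hsS => ?_⟩, t - a, ⟨by linarith, by linarith⟩, ?_⟩
  · simpa using haA.2
  · simpa using hbA.2
  · have hmem : a + s ∈ A :=
      ⟨⟨by linarith [haA.1.1, hs.1], by linarith [hbA.1.2, hs.2]⟩, hsS⟩
    have h1 := hs.1
    have h2 := hs.2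
    rcases lt_trichotomy (a + s) t with hlt | heq | hgt
    · have : a + s ≤ a := hamax _ ⟨hmem, hlt⟩
      linarith
    · rw [← heq] at htS
      exact htS hsS
    · have : b ≤ a + s := hbmin _ ⟨hmem, hgt⟩
      linarith
  · simp

/-- Every finite set of points of a metric graph is contained in the vertex set of a finite
subdivision. -/
theorem IsMetricGraph.exists_subdivision (hΓ : IsMetricGraph Γ) (F : Finset Γ) :
    ∃ S : Finset Γ, F ⊆ S ∧
      ∀ x, x ∉ S → ∃ τ ℓ, IsEdge (S : Set Γ) τ ℓ ∧ x ∈ τ '' Set.Ioo 0 ℓ := by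
  classical
  have := hΓ.1
  choose hn σ ρ hσ using fun P => hΓ.exists_isLocalStar (Γ := Γ) P
  obtain ⟨T, hT⟩ := isCompact_univ.elim_finite_subcover (fun P => Metric.ball P (ρ P / 2))
    (fun _ => Metric.isOpen_ball)
    (fun P _ => Set.mem_iUnion.2 ⟨P, Metric.mem_ball_self (half_pos (hσ P).pos)⟩)
  let S : Finset Γ := F ∪ T ∪ T.biUnion fun P => Finset.univ.image fun i => σ P i (ρ P / 2)
  refine ⟨S, fun x hx => by simp [S, hx], fun x hx => ?_⟩
  obtain ⟨P, hPT, hxP⟩ : ∃ P ∈ T, x ∈ Metric.ball P (ρ P / 2) := by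
    simpa using hT (Set.mem_univ x)
  have hρ := (hσ P).pos
  obtain ⟨i, t, ht, rfl⟩ := (hσ P).cover x (Metric.ball_subset_ball (by linarith) hxP)
  have htρ : t < ρ P / 2 := by
    rwa [Metric.mem_ball, (hσ P).dist_base i ⟨ht.1, ht.2.le⟩] at hxP
  have harc : IsOpenArc (σ P i) (ρ P) := ⟨hρ, (hσ P).isom i, (hσ P).isOpen_ray i⟩
  have hhalf : IsOpenArc (σ P i) (ρ P / 2) := by
    simpa using harc.subarc le_rfl (half_pos hρ) (by linarith)
  refine hhalf.exists_isEdge S.finite_toSet ?_ ?_ ⟨ht.1, htρ.le⟩ hx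
  · rw [(hσ P).base]
    simp [S, hPT]
  · have : σ P i (ρ P / 2) ∈ T.biUnion fun P => Finset.univ.image fun i => σ P i (ρ P / 2) :=
      Finset.mem_biUnion.2 ⟨P, hPT, Finset.mem_image_of_mem _ (Finset.mem_univ _)⟩
    exact Finset.mem_union_right _ this

end Edges

/-! ### Connected components of complements of finite sets -/

section Components

variable {Γ : Type*} [MetricSpace Γ]

theorem IsArcAt.exists_notMem {P : Γ} {τ : ℝ → Γ} (h : IsArcAt P τ) {S : Set Γ} (hS : S.Finite) :
    ∃ ε > 0, (∀ s ∈ Set.Icc 0 ε, ∀ t ∈ Set.Icc 0 ε, dist (τ s) (τ t) = |s - t|) ∧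
      ∀ t ∈ Set.Ioc 0 ε, τ t ∉ S := by
  obtain ⟨hP, a, ha, hτ⟩ := h
  have hnhds : (S \ {P})ᶜ ∈ nhds P :=
    (hS.subset Set.sdiff_subset).isClosed.isOpen_compl.mem_nhds fun h => h.2 rfl
  obtain ⟨δ, hδ, hball⟩ := Metric.mem_nhds_iff.1 hnhds
  refine ⟨min a (δ / 2), lt_min ha (half_pos hδ), fun s hs t ht =>
    hτ s ⟨hs.1, hs.2.trans (min_le_left _ _)⟩ t ⟨ht.1, ht.2.trans (min_le_left _ _)⟩,
    fun t ht htS => ?_⟩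
  have hd : dist (τ t) P = t := by
    rw [← hP, hτ t ⟨ht.1.le, ht.2.trans (min_le_left _ _)⟩ 0 ⟨le_rfl, ha.le⟩, sub_zero,
      abs_of_pos ht.1]
  have hmem : τ t ∈ Metric.ball P δ := by
    rw [Metric.mem_ball, hd]
    linarith [ht.2.trans (min_le_right a (δ / 2))]
  refine hball hmem ⟨htS, fun he => ?_⟩
  rw [Set.mem_singleton_iff.1 he, dist_self] at hd
  exact ht.1.ne hd

theorem continuousOn_of_dist_eq {τ : ℝ → Γ} {I : Set ℝ}
    (h : ∀ s ∈ I, ∀ t ∈ I, dist (τ s) (τ t) = |s - t|) : ContinuousOn τ I :=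
  (LipschitzOnWith.of_dist_le_mul (K := 1) fun s hs t ht => by
    rw [h s hs t ht, NNReal.coe_one, one_mul, Real.dist_eq]).continuousOn

theorem mk_eq_mk_of_isPreconnected {T K : Set Γ} (hK : IsPreconnected K) (hKT : ∀ x ∈ K, x ∉ T)
    (x y : {x // x ∉ T}) (hx : (x : Γ) ∈ K) (hy : (y : Γ) ∈ K) :
    (x : ConnectedComponents {x // x ∉ T}) = y := by
  have hpre : IsPreconnected (Subtype.val ⁻¹' K : Set {x // x ∉ T}) := by
    refine (Topology.IsInducing.subtypeVal (t := Tᶜ)).isPreconnected_image.1 ?_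
    have hKT' : Subtype.val '' (Subtype.val ⁻¹' K : Set ↥Tᶜ) = K := by
      rw [Subtype.image_preimage_coe]
      exact Set.inter_eq_right.2 hKT
    exact hKT'.symm ▸ hK
  exact ConnectedComponents.coe_eq_coe'.2 (hpre.subset_connectedComponent hy hx)

theorem IsMetricGraph.locallyConnectedSpace (hΓ : IsMetricGraph Γ) : LocallyConnectedSpace Γ := by
  choose hn σ ρ hσ using fun P => hΓ.exists_isLocalStar (Γ := Γ) P
  refine locallyConnectedSpace_of_connected_bases (fun P ε => Metric.ball P ε)
    (fun P ε => 0 < ε ∧ ε ≤ ρ P) (fun P => ?_) fun P ε hε => ?_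
  · exact Metric.nhds_basis_ball.to_hasBasis
      (fun ε hε => ⟨min ε (ρ P), ⟨lt_min hε (hσ P).pos, min_le_right _ _⟩,
        Metric.ball_subset_ball (min_le_left _ _)⟩)
      fun ε hε => ⟨ε, hε.1, subset_rfl⟩
  · have : Metric.ball P ε = ⋃ i, σ P i '' Set.Ico 0 ε := by
      ext x
      simp only [Set.mem_iUnion]
      constructor
      · intro hx
        obtain ⟨i, t, ht, rfl⟩ := (hσ P).cover x (Metric.ball_subset_ball hε.2 hx)
        rw [Metric.mem_ball, (hσ P).dist_base i ⟨ht.1, ht.2.le⟩] at hx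
        exact ⟨i, t, ⟨ht.1, hx⟩, rfl⟩
      · rintro ⟨i, t, ht, rfl⟩
        rw [Metric.mem_ball, (hσ P).dist_base i ⟨ht.1, ht.2.le.trans hε.2⟩]
        exact ht.2
    rw [this]
    refine isPreconnected_iUnion ⟨P, ?_⟩ ?_
    · exact Set.mem_iInter.2 fun i => ⟨0, ⟨le_rfl, hε.1⟩, (hσ P).base i⟩
    · exact fun i => isPreconnected_Ico.image _ ((continuousOn_of_dist_eq ((hσ P).isom i)).mono
        fun t ht => ⟨ht.1, ht.2.le.trans hε.2⟩)

/-- The map on components induced by shrinking the complement of `T` to that of `T'`. -/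
def componentsMap {T T' : Set Γ} (h : T ⊆ T') :
    ConnectedComponents {x // x ∉ T'} → ConnectedComponents {x // x ∉ T} :=
  (continuous_inclusion (Set.compl_subset_compl.2 h)).connectedComponentsMap

theorem componentsMap_mk {T T' : Set Γ} (h : T ⊆ T') (x : {x // x ∉ T'}) :
    componentsMap h (x : ConnectedComponents {x // x ∉ T'}) =
      ((⟨x, fun hx => x.2 (h hx)⟩ : {x // x ∉ T}) : ConnectedComponents {x // x ∉ T}) :=
  rfl

theorem IsMetricGraph.componentsMap_surjective (hΓ : IsMetricGraph Γ) {T T' : Set Γ} (h : T ⊆ T')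
    (hT' : T'.Finite) : Function.Surjective (componentsMap h) := by
  intro c
  obtain ⟨⟨x, hx⟩, rfl⟩ := ConnectedComponents.surjective_coe c
  obtain ⟨hn, σ, ρ, hσ⟩ := hΓ.exists_isLocalStar x
  obtain ⟨ε, hε, hiso, hav⟩ := (hσ.isArcSystem.arc ⟨0, hn⟩).exists_notMem hT'
  refine ⟨((⟨_, hav ε ⟨hε, le_rfl⟩⟩ : {x // x ∉ T'}) : ConnectedComponents {x // x ∉ T'}), ?_⟩
  rw [componentsMap_mk]
  refine mk_eq_mk_of_isPreconnected
    (isPreconnected_Icc.image _ (continuousOn_of_dist_eq hiso)) ?_ _ _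
    ⟨ε, ⟨hε.le, le_rfl⟩, rfl⟩ ⟨0, ⟨le_rfl, hε.le⟩, hσ.base _⟩
  rintro _ ⟨t, ht, rfl⟩
  rcases ht.1.eq_or_lt with rfl | h0
  · rwa [hσ.base]
  · exact fun hT => hav t ⟨h0, ht.2⟩ (h hT)

/-- Removing a point of valence two creates at most one new component. -/
theorem IsMetricGraph.card_components_insert_le (hΓ : IsMetricGraph Γ) {T : Set Γ}
    (hT : T.Finite) {p : Γ} (hval : valence Γ p = 2)
    [Finite (ConnectedComponents {x // x ∉ T})] :
    Nat.card (ConnectedComponents {x // x ∉ insert p T}) ≤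
      Nat.card (ConnectedComponents {x // x ∉ T}) + 1 := by
  classical
  have := hΓ.locallyConnectedSpace
  have hT' : (insert p T).Finite := hT.insert p
  have hopen : IsOpen (insert p T)ᶜ := hT'.isClosed.isOpen_compl
  have : LocallyConnectedSpace {x // x ∉ insert p T} := hopen.locallyConnectedSpace
  have hemb : Topology.IsOpenEmbedding (Subtype.val : {x // x ∉ insert p T} → Γ) :=
    hopen.isOpenEmbedding_subtypeVal
  have hstar := (hΓ.exists_isLocalStar p).2
  rw [hval] at hstar
  obtain ⟨σ, ρ, hσ⟩ := hstar
  choose ε hε hiso hav using fun i => (hσ.isArcSystem.arc i).exists_notMem hT'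
  let r : Fin 2 → ConnectedComponents {x // x ∉ insert p T} := fun i =>
    ((⟨σ i (ε i), hav i _ ⟨hε i, le_rfl⟩⟩ : {x // x ∉ insert p T}) : ConnectedComponents _)
  have hr : ∀ i (y : {x // x ∉ insert p T}), (y : Γ) ∈ σ i '' Set.Ioc 0 (ε i) →
      (y : ConnectedComponents {x // x ∉ insert p T}) = r i := fun i y hy => by
    refine mk_eq_mk_of_isPreconnected (isPreconnected_Ioc.image _
      ((continuousOn_of_dist_eq (hiso i)).mono Set.Ioc_subset_Icc_self)) ?_ _ _ hy
      ⟨ε i, ⟨hε i, le_rfl⟩, rfl⟩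
    rintro _ ⟨t, ht, rfl⟩
    exact hav i t ht
  obtain ⟨δ, hδ, hδρ, hδε⟩ : ∃ δ > 0, δ ≤ ρ ∧ ∀ i, δ ≤ ε i := by
    refine ⟨min ρ (min (ε 0) (ε 1)), lt_min hσ.pos (lt_min (hε 0) (hε 1)), min_le_left _ _, ?_⟩
    intro i
    fin_cases i
    · exact (min_le_right _ _).trans (min_le_left _ _)
    · exact (min_le_right _ _).trans (min_le_right _ _)
  have key : ∀ x y : {x // x ∉ insert p T},
      componentsMap (Set.subset_insert p T) (x : ConnectedComponents {x // x ∉ insert p T}) =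
        componentsMap (Set.subset_insert p T) y →
      (∀ i, (x : ConnectedComponents {x // x ∉ insert p T}) ≠ r i) →
      (x : ConnectedComponents {x // x ∉ insert p T}) = y := by
    intro x y hxy hx
    set A := connectedComponent x with hA
    set B : Set Γ := Subtype.val '' A with hB
    have hBopen : IsOpen B := hemb.isOpenMap _ isOpen_connectedComponent
    have hAc : IsOpen (Subtype.val '' Aᶜ : Set Γ) :=
      hemb.isOpenMap _ isClosed_connectedComponent.isOpen_compl
    have hcompl : (Subtype.val ⁻¹' B : Set {x // x ∉ T})ᶜ =
        Subtype.val ⁻¹' (Subtype.val '' Aᶜ ∪ Metric.ball p δ) := by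
      ext ⟨z, hz⟩
      simp only [Set.mem_compl_iff, Set.mem_preimage, Set.mem_union]
      constructor
      · intro hzB
        by_cases hzp : z = p
        · exact Or.inr (hzp ▸ Metric.mem_ball_self hδ)
        · have hz' : z ∉ insert p T := fun h => h.elim hzp hz
          exact Or.inl ⟨⟨z, hz'⟩, fun h => hzB ⟨_, h, rfl⟩, rfl⟩
      · rintro (⟨w, hw, rfl⟩ | hzball) ⟨w', hw', he⟩
        · exact hw (Subtype.ext he ▸ hw')
        · obtain ⟨i, t, ht, rfl⟩ := hσ.cover z (Metric.ball_subset_ball hδρ hzball)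
          rw [Metric.mem_ball, hσ.dist_base i ⟨ht.1, ht.2.le⟩] at hzball
          rcases ht.1.eq_or_lt with rfl | h0
          · rw [hσ.base] at he
            exact w'.2 (Or.inl he)
          · refine hx i ?_
            rw [← hr i w' (he ▸ ⟨t, ⟨h0, hzball.le.trans (hδε i)⟩, rfl⟩)]
            exact (ConnectedComponents.coe_eq_coe'.2 hw').symm
    have hclopen : IsClopen (Subtype.val ⁻¹' B : Set {x // x ∉ T}) := by
      refine ⟨⟨?_⟩, hBopen.preimage continuous_subtype_val⟩
      rw [hcompl]
      exact (hAc.union Metric.isOpen_ball).preimage continuous_subtype_val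
    rw [componentsMap_mk, componentsMap_mk, eq_comm, ConnectedComponents.coe_eq_coe'] at hxy
    obtain ⟨w, hw, he⟩ := hclopen.connectedComponent_subset
      (show _ ∈ Subtype.val ⁻¹' B from ⟨x, mem_connectedComponent, rfl⟩) hxy
    have : w = y := Subtype.ext he
    subst this
    exact (ConnectedComponents.coe_eq_coe'.2 hw).symm
  let F : ConnectedComponents {x // x ∉ insert p T} → Option (ConnectedComponents {x // x ∉ T}) :=
    fun c => if c = r 0 then none else some (componentsMap (Set.subset_insert p T) c)
  have hF : Function.Injective F := by
    intro c c' hcc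
    simp only [F] at hcc
    split_ifs at hcc with h1 h2 h2
    · rw [h1, h2]
    · replace hcc := Option.some_injective _ hcc
      obtain ⟨x, rfl⟩ := ConnectedComponents.surjective_coe c
      obtain ⟨y, rfl⟩ := ConnectedComponents.surjective_coe c'
      by_cases hx : (x : ConnectedComponents {x // x ∉ insert p T}) = r 1
      · by_cases hy : (y : ConnectedComponents {x // x ∉ insert p T}) = r 1
        · rw [hx, hy]
        · exact (key y x hcc.symm (Fin.forall_fin_two.2 ⟨h2, hy⟩)).symm
      · exact key x y hcc (Fin.forall_fin_two.2 ⟨h1, hx⟩)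
  have := Nat.card_le_card_of_injective F hF
  rwa [Finite.card_option] at this

theorem IsMetricGraph.card_components_union_le (hΓ : IsMetricGraph Γ) {T : Set Γ} (hT : T.Finite)
    (W : Finset Γ) (hW : ∀ p ∈ W, valence Γ p = 2)
    (hfin : Finite (ConnectedComponents {x // x ∉ T ∪ W})) :
    Nat.card (ConnectedComponents {x // x ∉ T ∪ W}) ≤
      Nat.card (ConnectedComponents {x // x ∉ T}) + W.card := by
  classical
  induction W using Finset.induction_on with
  | empty => rw [Finset.coe_empty, Set.union_empty, Finset.card_empty, add_zero]
  | insert p W hpW ih =>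
    rw [Finset.coe_insert, Set.union_insert] at hfin ⊢
    have hTW : (T ∪ W).Finite := hT.union W.finite_toSet
    have hfin' : Finite (ConnectedComponents {x // x ∉ T ∪ W}) :=
      Finite.of_surjective _
        (hΓ.componentsMap_surjective (Set.subset_insert p (T ∪ W)) (hTW.insert p))
    have h1 := hΓ.card_components_insert_le hTW (hW p (Finset.mem_insert_self _ _))
    have h2 := ih (fun q hq => hW q (Finset.mem_insert_of_mem hq)) hfin'
    rw [Finset.card_insert_of_notMem hpW]
    omega

end Components

/-! ### Subdivisions -/

section Subdivisions

variable {Γ : Type*} [MetricSpace Γ]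

namespace IsEdge

variable {S : Set Γ} {τ : ℝ → Γ} {ℓ : ℝ}

theorem reverse (h : IsEdge S τ ℓ) : IsEdge S (fun t => τ (ℓ - t)) ℓ := by
  refine ⟨h.toIsOpenArc.reverse, by simpa using h.right_mem, by simpa using h.left_mem,
    fun t ht => h.notMem _ ⟨?_, ?_⟩⟩
  · linarith [ht.2]
  · linarith [ht.1]

theorem mem_Ioo_of_notMem (h : IsEdge S τ ℓ) {x : Γ} (hx : x ∈ τ '' Set.Icc 0 ℓ) (hxS : x ∉ S) :
    x ∈ τ '' Set.Ioo 0 ℓ := by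
  obtain ⟨t, ht, rfl⟩ := hx
  refine ⟨t, ⟨ht.1.lt_of_ne ?_, ht.2.lt_of_ne ?_⟩, rfl⟩
  · rintro rfl
    exact hxS h.left_mem
  · rintro rfl
    exact hxS h.right_mem

theorem isClosed_image_Icc (h : IsEdge S τ ℓ) : IsClosed (τ '' Set.Icc 0 ℓ) :=
  (isCompact_Icc.image_of_continuousOn h.continuousOn).isClosed

theorem mk_eq_mk (h : IsEdge S τ ℓ) (x y : {x // x ∉ S}) (hx : (x : Γ) ∈ τ '' Set.Ioo 0 ℓ)
    (hy : (y : Γ) ∈ τ '' Set.Ioo 0 ℓ) : (x : ConnectedComponents {x // x ∉ S}) = y := by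
  refine mk_eq_mk_of_isPreconnected (isPreconnected_Ioo.image _
    (h.continuousOn.mono Set.Ioo_subset_Icc_self)) ?_ x y hx hy
  rintro _ ⟨t, ht, rfl⟩
  exact h.notMem t ht

theorem mem_of_mk_eq_mk (h : IsEdge S τ ℓ) (x y : {x // x ∉ S})
    (hx : (x : Γ) ∈ τ '' Set.Ioo 0 ℓ) (hxy : (x : ConnectedComponents {x // x ∉ S}) = y) :
    (y : Γ) ∈ τ '' Set.Ioo 0 ℓ := by
  have hclopen : IsClopen (Subtype.val ⁻¹' (τ '' Set.Ioo 0 ℓ) : Set {x // x ∉ S}) := by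
    refine ⟨?_, h.isOpen.preimage continuous_subtype_val⟩
    have : (Subtype.val ⁻¹' (τ '' Set.Ioo 0 ℓ) : Set {x // x ∉ S}) =
        Subtype.val ⁻¹' (τ '' Set.Icc 0 ℓ) := by
      ext z
      exact ⟨fun hz => Set.image_mono Set.Ioo_subset_Icc_self hz,
        fun hz => h.mem_Ioo_of_notMem hz z.2⟩
    rw [this]
    exact h.isClosed_image_Icc.preimage continuous_subtype_val
  exact hclopen.connectedComponent_subset hx (ConnectedComponents.coe_eq_coe'.1 hxy.symm)

/-- An arc at a marked point running into an edge follows that edge from one of its ends. -/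
theorem arcEquiv_or (h : IsEdge S τ ℓ) {P : Γ} (hP : P ∈ S) {σ : ℝ → Γ} (hσ0 : σ 0 = P) {ε : ℝ}
    (hε : 0 < ε) (hσ : ∀ s ∈ Set.Icc 0 ε, ∀ t ∈ Set.Icc 0 ε, dist (σ s) (σ t) = |s - t|)
    (hsub : ∀ t ∈ Set.Ioc 0 ε, σ t ∈ τ '' Set.Ioo 0 ℓ) :
    (τ 0 = P ∧ ArcEquiv σ τ) ∨ (τ ℓ = P ∧ ArcEquiv σ fun t => τ (ℓ - t)) := by
  have hd : ∀ t ∈ Set.Icc 0 ε, dist (σ t) P = t := fun t ht => by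
    rw [← hσ0, hσ t ht 0 ⟨le_rfl, hε.le⟩, sub_zero, abs_of_nonneg ht.1]
  have hcl : P ∈ τ '' Set.Icc 0 ℓ := by
    rw [← h.isClosed_image_Icc.closure_eq, Metric.mem_closure_iff]
    intro δ hδ
    have hm : 0 < min ε (δ / 2) := lt_min hε (half_pos hδ)
    refine ⟨σ (min ε (δ / 2)), Set.image_mono Set.Ioo_subset_Icc_self
      (hsub _ ⟨hm, min_le_left _ _⟩), ?_⟩
    rw [dist_comm, hd _ ⟨hm.le, min_le_left _ _⟩]
    linarith [min_le_right ε (δ / 2)]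
  obtain ⟨u, hu, huP⟩ := hcl
  rcases hu.1.eq_or_lt with rfl | hu0
  · refine Or.inl ⟨huP, ε, hε, fun t ht => ?_⟩
    rcases ht.1.eq_or_lt with rfl | ht0
    · rw [hσ0, huP]
    obtain ⟨s, hs, hst⟩ := hsub t ⟨ht0, ht.2⟩
    have h1 := hd t ht
    rw [← hst, ← huP, h.dist_left (Set.Ioo_subset_Icc_self hs)] at h1
    rw [← hst, h1]
  rcases hu.2.eq_or_lt with rfl | huℓ
  · refine Or.inr ⟨huP, ε, hε, fun t ht => ?_⟩
    rcases ht.1.eq_or_lt with rfl | ht0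
    · simp only [hσ0, sub_zero, huP]
    obtain ⟨s, hs, hst⟩ := hsub t ⟨ht0, ht.2⟩
    have h1 := hd t ht
    rw [← hst, ← huP, h.isom s (Set.Ioo_subset_Icc_self hs) u hu, abs_sub_comm,
      abs_of_pos (sub_pos.2 hs.2)] at h1
    rw [← hst, ← h1]
    simp only [sub_sub_cancel]
  · exact absurd (huP ▸ hP) (h.notMem u ⟨hu0, huℓ⟩)

end IsEdge

/-- A subdivision of `Γ` with vertex set `S` and edges `τ e` of length `ℓ e`. -/
structure IsSubdivision (S : Set Γ) {E : Type*} (τ : E → ℝ → Γ) (ℓ : E → ℝ) : Prop where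
  edge : ∀ e, IsEdge S (τ e) (ℓ e)
  cover : ∀ x, x ∉ S → ∃ e, x ∈ τ e '' Set.Ioo 0 (ℓ e)
  eq_of_eq : ∀ e e', ∀ s ∈ Set.Ioo 0 (ℓ e), ∀ t ∈ Set.Ioo 0 (ℓ e'), τ e s = τ e' t → e = e'

theorem exists_isSubdivision_of_edges {S : Set Γ}
    (h : ∀ x, x ∉ S → ∃ τ ℓ, IsEdge S τ ℓ ∧ x ∈ τ '' Set.Ioo 0 ℓ) :
    ∃ (τ : ConnectedComponents {x // x ∉ S} → ℝ → Γ) (ℓ : ConnectedComponents {x // x ∉ S} → ℝ),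
      IsSubdivision S τ ℓ := by
  have hrep : ∀ c : ConnectedComponents {x // x ∉ S}, ∃ x : {x // x ∉ S},
      (x : ConnectedComponents {x // x ∉ S}) = c := ConnectedComponents.surjective_coe
  choose x hx using hrep
  choose τ ℓ hE hmem using fun c => h (x c) (x c).2
  have hmk : ∀ c (y : {x // x ∉ S}), (y : Γ) ∈ τ c '' Set.Ioo 0 (ℓ c) →
      (y : ConnectedComponents {x // x ∉ S}) = c := fun c y hy => by
    rw [← hx c]
    exact (hE c).mk_eq_mk _ _ hy (hmem c)
  refine ⟨τ, ℓ, hE, fun y hy => ⟨((⟨y, hy⟩ : {x // x ∉ S}) : ConnectedComponents _),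
    (hE _).mem_of_mk_eq_mk _ ⟨y, hy⟩ (hmem _) (hx _)⟩, fun c c' s hs t ht he => ?_⟩
  have hy := (hE c).notMem s hs
  rw [← hmk c ⟨_, hy⟩ ⟨s, hs, rfl⟩, ← hmk c' ⟨_, hy⟩ ⟨t, ht, he.symm⟩]

namespace IsSubdivision

variable {S : Set Γ} {E : Type*} {τ : E → ℝ → Γ} {ℓ : E → ℝ}

/-- The end of an edge from which a half-edge emanates. -/
def dartBase (τ : E → ℝ → Γ) (ℓ : E → ℝ) (d : E × Bool) : Γ :=
  if d.2 then τ d.1 0 else τ d.1 (ℓ d.1)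

/-- The arc running along a half-edge. -/
def dart (τ : E → ℝ → Γ) (ℓ : E → ℝ) (d : E × Bool) : ℝ → Γ :=
  if d.2 then τ d.1 else fun t => τ d.1 (ℓ d.1 - t)

theorem dart_isEdge (h : IsSubdivision S τ ℓ) (d : E × Bool) :
    IsEdge S (dart τ ℓ d) (ℓ d.1) := by
  obtain ⟨e, b⟩ := d
  cases b
  · exact (h.edge e).reverse
  · exact h.edge e

theorem dart_zero {Γ : Type*} {τ : E → ℝ → Γ} (d : E × Bool) : dart τ ℓ d 0 = dartBase τ ℓ d := by
  obtain ⟨e, b⟩ := d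
  cases b <;> simp [dart, dartBase]

theorem left_ne_right (h : IsSubdivision S τ ℓ) (e : E) : τ e 0 ≠ τ e (ℓ e) := fun he =>
  (h.edge e).pos.ne
    ((h.edge e).injOn ⟨le_rfl, (h.edge e).pos.le⟩ ⟨(h.edge e).pos.le, le_rfl⟩ he)

theorem fst_eq_of_arcEquiv (h : IsSubdivision S τ ℓ) {d d' : E × Bool}
    (hd : ArcEquiv (dart τ ℓ d) (dart τ ℓ d')) : d.1 = d'.1 := by
  obtain ⟨ε, hε, he⟩ := hd
  have hpos := (h.edge d.1).pos
  have hpos' := (h.edge d'.1).pos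
  obtain ⟨t, ht0, htε, ht, ht'⟩ : ∃ t, 0 < t ∧ t ≤ ε ∧ t < ℓ d.1 ∧ t < ℓ d'.1 := by
    have h1 := min_le_left ε (min (ℓ d.1 / 2) (ℓ d'.1 / 2))
    have h2 := min_le_right ε (min (ℓ d.1 / 2) (ℓ d'.1 / 2))
    have h3 := min_le_left (ℓ d.1 / 2) (ℓ d'.1 / 2)
    have h4 := min_le_right (ℓ d.1 / 2) (ℓ d'.1 / 2)
    exact ⟨min ε (min (ℓ d.1 / 2) (ℓ d'.1 / 2)),
      lt_min hε (lt_min (half_pos hpos) (half_pos hpos')), h1, by linarith, by linarith⟩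
  have hint : ∀ d : E × Bool, t < ℓ d.1 →
      ∃ s ∈ Set.Ioo 0 (ℓ d.1), dart τ ℓ d t = τ d.1 s := by
    rintro ⟨e, b⟩ hte
    cases b
    · exact ⟨ℓ e - t, ⟨sub_pos.2 hte, sub_lt_self _ ht0⟩, rfl⟩
    · exact ⟨t, ⟨ht0, hte⟩, rfl⟩
  obtain ⟨s, hs, hse⟩ := hint d ht
  obtain ⟨s', hs', hse'⟩ := hint d' ht'
  exact h.eq_of_eq _ _ s hs s' hs' (by rw [← hse, ← hse', he t ⟨ht0.le, htε⟩])

/-- The half-edges emanating from a vertex of a subdivision represent all directions there. -/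
theorem isArcSystem (h : IsSubdivision S τ ℓ) (hS : S.Finite) {P : Γ} (hP : P ∈ S) :
    IsArcSystem P fun d : {d : E × Bool // dartBase τ ℓ d = P} => dart τ ℓ d := by
  refine ⟨fun d => ?_, fun d d' hdd hequiv => hdd (Subtype.ext ?_), fun σ hσ => ?_⟩
  · have := (h.dart_isEdge d).isArcAt
    rwa [dart_zero, d.2] at this
  · obtain ⟨⟨e, b⟩, hd⟩ := d
    obtain ⟨⟨e', b'⟩, hd'⟩ := d'
    obtain rfl : e = e' := h.fst_eq_of_arcEquiv hequiv
    have hne := h.left_ne_right e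
    cases b <;> cases b' <;> simp only [dartBase, if_true, Bool.false_eq_true, if_false] at hd hd'
    · rfl
    · exact absurd (hd'.trans hd.symm) hne
    · exact absurd (hd.trans hd'.symm) hne
    · rfl
  · obtain ⟨ε, hε, hiso, hav⟩ := hσ.exists_notMem hS
    obtain ⟨e, he⟩ := h.cover _ (hav ε ⟨hε, le_rfl⟩)
    have hsub : σ '' Set.Ioc 0 ε ⊆ τ e '' Set.Ioo 0 (ℓ e) := by
      refine (isPreconnected_Ioc.image _ ((continuousOn_of_dist_eq hiso).mono
        Set.Ioc_subset_Icc_self)).subset_of_closure_inter_subset (h.edge e).isOpen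
        ⟨_, ⟨ε, ⟨hε, le_rfl⟩, rfl⟩, he⟩ ?_
      rintro x ⟨hx, t, ht, rfl⟩
      exact (h.edge e).mem_Ioo_of_notMem (closure_minimal
        (Set.image_mono Set.Ioo_subset_Icc_self) (h.edge e).isClosed_image_Icc hx) (hav t ht)
    rcases (h.edge e).arcEquiv_or hP hσ.1 hε hiso (fun t ht => hsub ⟨t, ht, rfl⟩) with
      ⟨h0, heq⟩ | ⟨h1, heq⟩
    · exact ⟨⟨(e, true), by simpa [dartBase] using h0⟩, heq⟩
    · exact ⟨⟨(e, false), by simpa [dartBase] using h1⟩, heq⟩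

theorem finite (hΓ : IsMetricGraph Γ) (hS : S.Finite) (h : IsSubdivision S τ ℓ) : Finite E := by
  have := hS.to_subtype
  choose hn σ ρ hσ using fun P => hΓ.exists_isLocalStar (Γ := Γ) P
  choose i hi using fun e => (hσ (τ e 0)).isArcSystem.exhaust (τ e) (h.edge e).isArcAt
  refine Finite.of_injective (β := Σ P : S, Fin (valence Γ P))
    (fun e => ⟨⟨τ e 0, (h.edge e).left_mem⟩, i e⟩) fun e e' hee => ?_
  have key : ∀ (x y : Σ P : S, Fin (valence Γ P)), x = y → σ x.1 x.2 = σ y.1 y.2 := by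
    rintro x _ rfl
    rfl
  have hσe : σ (τ e 0) (i e) = σ (τ e' 0) (i e') := key _ _ hee
  exact h.fst_eq_of_arcEquiv (d := (e, true)) (d' := (e', true))
    ((hi e).trans (hσe ▸ (hi e').symm))

variable [Fintype E]

open scoped Classical in
theorem sum_darts {Γ M : Type*} [AddCommMonoid M] {τ : E → ℝ → Γ} (P : Γ) (g : E × Bool → M) :
    ∑ d : {d : E × Bool // dartBase τ ℓ d = P}, g d =
      ∑ e, ((if τ e 0 = P then g (e, true) else 0) +
        if τ e (ℓ e) = P then g (e, false) else 0) := by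
  rw [← Finset.sum_subtype (Finset.univ.filter fun d => dartBase τ ℓ d = P) (by simp) g,
    Finset.sum_filter, Fintype.sum_prod_type]
  simp [dartBase]

open scoped Classical in
theorem valence_eq (hΓ : IsMetricGraph Γ) (h : IsSubdivision S τ ℓ) (hS : S.Finite) {P : Γ}
    (hP : P ∈ S) : (valence Γ P : ℤ) =
      ∑ e, ((if τ e 0 = P then 1 else 0) + if τ e (ℓ e) = P then 1 else 0) := by
  rw [← sum_darts P fun _ => (1 : ℤ), hΓ.valence_eq_card (h.isArcSystem hS hP)]
  simp

open scoped Classical in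
/-- A rational function whose zeros and poles are vertices has a constant slope on each edge, and
its order at a vertex is the sum of the outgoing slopes. -/
theorem exists_slopes (h : IsSubdivision S τ ℓ) (hS : S.Finite) {f : Γ → ℝ} (hf : IsRational Γ f)
    {m : Γ → ℤ} (hm : ∀ P, HasOrderAt Γ f P (m P)) (hm0 : ∀ P, P ∉ S → m P = 0) :
    ∃ s : E → ℤ, (∀ e, f (τ e (ℓ e)) - f (τ e 0) = s e * ℓ e) ∧
      ∀ P ∈ S, m P = ∑ e, ((if τ e 0 = P then s e else 0) - if τ e (ℓ e) = P then s e else 0) := by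
  choose s hs using fun e => hf.2 _ _ (h.edge e).isArcAt
  have haff : ∀ e, ∀ t ∈ Set.Icc 0 (ℓ e), f (τ e t) = f (τ e 0) + s e * t := fun e =>
    (h.edge e).affine hf (fun t ht => hm0 _ ((h.edge e).notMem t ht) ▸ hm (τ e t)) (hs e)
  have hend : ∀ e, f (τ e (ℓ e)) = f (τ e 0) + s e * ℓ e := fun e =>
    haff e _ ⟨(h.edge e).pos.le, le_rfl⟩
  refine ⟨s, fun e => by rw [hend]; ring, fun P hP => ?_⟩
  have hslope : ∀ d, HasSlopeAlong f (dart τ ℓ d) (if d.2 then s d.1 else -s d.1) := by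
    rintro ⟨e, b⟩
    cases b
    · refine ⟨ℓ e, (h.edge e).pos, fun t ht => ?_⟩
      simp only [dart, Bool.false_eq_true, if_false, sub_zero]
      rw [hend, haff e _ ⟨sub_nonneg.2 ht.2, sub_le_self _ ht.1⟩]
      push_cast
      ring
    · exact hs e
  rw [(hm P).eq_sum (h.isArcSystem hS hP) (fun d => hslope d),
    sum_darts P fun d => if d.2 then s d.1 else -s d.1]
  refine Finset.sum_congr rfl fun e _ => ?_
  simp only [if_true, Bool.false_eq_true, if_false]
  split_ifs <;> ring

end IsSubdivision

end Subdivisions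

/-! ### Divisors of degree one on a finite weighted graph -/

/-- On a finite weighted graph with more edges than vertices, the vertices are not all linearly
equivalent to a fixed divisor `c`. Here `a e` and `b e` are the ends of the edge `e`, and a function
`F` on the vertices, interpolated linearly, has slope `m e` along `e`. -/
theorem false_of_forall_vertex_equiv {V E : Type*} [Fintype V] [Fintype E] [DecidableEq V]
    (a b : E → V) (ℓ : E → ℝ) (hℓ : ∀ e, 0 < ℓ e) (hab : ∀ e, a e ≠ b e)
    (hcard : Fintype.card V < Fintype.card E) (c : V → ℤ)
    (h : ∀ P, ∃ (F : V → ℝ) (m : E → ℤ), (∀ e, F (b e) - F (a e) = m e * ℓ e) ∧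
      ∀ v, (if P = v then 1 else 0) - c v =
        ∑ e, ((if a e = v then m e else 0) - if b e = v then m e else 0)) : False := by
  classical
  let bd : (E → ℝ) →ₗ[ℝ] (V → ℝ) :=
    { toFun := fun w v => ∑ e, ((if a e = v then w e else 0) - if b e = v then w e else 0)
      map_add' := fun w w' => by
        ext v
        simp only [Pi.add_apply, ← Finset.sum_add_distrib]
        refine Finset.sum_congr rfl fun e _ => ?_
        split_ifs <;> ring
      map_smul' := fun r w => by
        ext v
        simp only [Pi.smul_apply, smul_eq_mul, RingHom.id_apply, Finset.mul_sum]
        refine Finset.sum_congr rfl fun e _ => ?_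
        split_ifs <;> ring }
  have hbd : ∀ w v, bd w v = ∑ e, ((if a e = v then w e else 0) - if b e = v then w e else 0) :=
    fun _ _ => rfl
  have hpair : ∀ (w : E → ℝ) (G : V → ℝ), bd w = 0 → ∑ e, w e * (G (b e) - G (a e)) = 0 := by
    intro w G hw
    have h1 : ∑ v, G v * bd w v = 0 := by simp [hw]
    simp only [hbd, Finset.mul_sum] at h1
    rw [Finset.sum_comm] at h1
    rw [← neg_eq_zero, ← Finset.sum_neg_distrib, ← h1]
    refine Finset.sum_congr rfl fun e _ => ?_
    simp only [mul_sub, mul_ite, mul_zero, Finset.sum_sub_distrib, Finset.sum_ite_eq,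
      Finset.mem_univ, if_true]
    ring
  obtain ⟨w, hw, hw0⟩ := Submodule.exists_mem_ne_zero_of_ne_bot
    (bd.ker_ne_bot_of_finrank_lt (by simpa using hcard))
  obtain ⟨e₀, he₀⟩ := Function.ne_iff.1 hw0
  obtain ⟨F₁, m₁, hF₁, hm₁⟩ := h (a e₀)
  obtain ⟨F₂, m₂, hF₂, hm₂⟩ := h (b e₀)
  set m : E → ℤ := fun e => m₁ e - m₂ e with hm
  have hF : ∀ e, (F₁ - F₂) (b e) - (F₁ - F₂) (a e) = m e * ℓ e := fun e => by
    simp only [Pi.sub_apply, hm]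
    push_cast
    linear_combination hF₁ e - hF₂ e
  have hdiv : ∀ v, ∑ e, ((if a e = v then m e else 0) - if b e = v then m e else 0) =
      (if a e₀ = v then 1 else 0) - if b e₀ = v then 1 else 0 := fun v => by
    have h1 : (if a e₀ = v then (1 : ℤ) else 0) - (if b e₀ = v then 1 else 0) =
        ((if a e₀ = v then 1 else 0) - c v) - ((if b e₀ = v then 1 else 0) - c v) := by ring
    rw [h1, hm₁, hm₂, ← Finset.sum_sub_distrib]
    refine Finset.sum_congr rfl fun e _ => ?_
    simp only [hm]
    split_ifs <;> ring
  have hker : bd ((fun e => (m e : ℝ)) - Pi.single e₀ 1) = 0 := by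
    rw [map_sub, sub_eq_zero]
    ext v
    have h1 := congrArg (Int.cast (R := ℝ)) (hdiv v)
    push_cast at h1
    rw [hbd, h1, hbd, Finset.sum_eq_single e₀ (fun e _ he => by simp [he]) (by simp)]
    simp
  have hsum : ∑ e, (((m e : ℝ) ^ 2 - if e = e₀ then (m e : ℝ) else 0) * ℓ e) = 0 := by
    refine (Finset.sum_congr rfl fun e _ => ?_).trans (hpair _ (F₁ - F₂) hker)
    rw [hF]
    by_cases he : e = e₀
    · subst he
      simp
      ring
    · simp [he]
      ring
  have hnonneg : ∀ e ∈ Finset.univ,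
      0 ≤ ((m e : ℝ) ^ 2 - if e = e₀ then (m e : ℝ) else 0) * ℓ e := fun e _ => by
    refine mul_nonneg ?_ (hℓ e).le
    split_ifs
    · have : m e ≤ m e ^ 2 := Int.le_self_sq _
      have : (m e : ℝ) ≤ (m e : ℝ) ^ 2 := by exact_mod_cast this
      linarith
    · simpa using sq_nonneg (m e : ℝ)
  have hzero := (Finset.sum_eq_zero_iff_of_nonneg hnonneg).1 hsum
  have hm0 : ∀ e, e ≠ e₀ → m e = 0 := fun e he => by
    have := hzero e (Finset.mem_univ e)
    simpa [he, (hℓ e).ne'] using this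
  have hme₀ : m e₀ = 0 := by
    have h1 := hpair w (F₁ - F₂) hw
    simp only [hF] at h1
    rw [Finset.sum_eq_single e₀ (fun e _ he => by simp [hm0 e he]) (by simp)] at h1
    have h2 : w e₀ ≠ 0 := he₀
    simpa [h2, (hℓ e₀).ne'] using h1
  have hall : ∀ e, m e = 0 := fun e => by
    by_cases he : e = e₀
    · rw [he, hme₀]
    · exact hm0 e he
  have := hdiv (a e₀)
  simp [hall, (hab e₀).symm] at this

/-! ### Degrees and ranks -/

section Degree

variable {Γ : Type*}

theorem divDeg_sub (D D' : Divisor Γ) : divDeg (D - D') = divDeg D - divDeg D' :=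
  Finsupp.sum_sub_index fun _ _ _ => rfl

theorem divDeg_single (P : Γ) (n : ℤ) : divDeg (Finsupp.single P n) = n :=
  Finsupp.sum_single_index rfl

theorem divDeg_eq_sum {D : Divisor Γ} {S : Finset Γ} (h : D.support ⊆ S) :
    divDeg D = ∑ P ∈ S, D P :=
  Finsupp.sum_of_support_subset D h _ fun _ _ => rfl

theorem Effective.divDeg_nonneg {D : Divisor Γ} (h : Effective D) : 0 ≤ divDeg D :=
  Finset.sum_nonneg fun P _ => h P

theorem Effective.eq_zero {D : Divisor Γ} (h : Effective D) (h0 : divDeg D = 0) : D = 0 := by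
  ext P
  by_contra hP
  exact hP ((Finset.sum_eq_zero_iff_of_nonneg fun P _ => h P).1 h0 P (Finsupp.mem_support_iff.2 hP))

theorem effective_single (P : Γ) {n : ℤ} (hn : 0 ≤ n) : Effective (Finsupp.single P n) := by
  classical
  intro Q
  rw [Finsupp.single_apply]
  split_ifs
  · exact hn
  · exact le_rfl

variable [MetricSpace Γ]

theorem IsMetricGraph.exists_isSubdivision (hΓ : IsMetricGraph Γ) (F : Finset Γ) :
    ∃ (S : Finset Γ) (τ : ConnectedComponents {x // x ∉ (S : Set Γ)} → ℝ → Γ)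
      (ℓ : ConnectedComponents {x // x ∉ (S : Set Γ)} → ℝ),
      F ⊆ S ∧ IsSubdivision (S : Set Γ) τ ℓ := by
  obtain ⟨S, hFS, hS⟩ := hΓ.exists_subdivision F
  obtain ⟨τ, ℓ, h⟩ := exists_isSubdivision_of_edges (S := (S : Set Γ)) hS
  exact ⟨S, τ, ℓ, hFS, h⟩

/-- Linearly equivalent divisors have the same degree. -/
theorem LinEquiv.divDeg_eq (hΓ : IsMetricGraph Γ) {D₁ D₂ : Divisor Γ} (h : LinEquiv Γ D₁ D₂) :
    divDeg D₁ = divDeg D₂ := by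
  classical
  obtain ⟨f, hf, hord⟩ := h
  obtain ⟨S, τ, ℓ, hFS, hsub⟩ := hΓ.exists_isSubdivision (D₁.support ∪ D₂.support)
  have := hsub.finite hΓ S.finite_toSet
  have := Fintype.ofFinite (ConnectedComponents {x // x ∉ (S : Set Γ)})
  have h₁ : D₁.support ⊆ S := Finset.subset_union_left.trans hFS
  have h₂ : D₂.support ⊆ S := Finset.subset_union_right.trans hFS
  obtain ⟨s, -, hs⟩ := hsub.exists_slopes S.finite_toSet hf (m := fun P => D₂ P - D₁ P) hord
    fun P hP => by
      rw [Finsupp.notMem_support_iff.1 fun h => hP (h₁ h),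
        Finsupp.notMem_support_iff.1 fun h => hP (h₂ h), sub_zero]
  rw [divDeg_eq_sum h₁, divDeg_eq_sum h₂, eq_comm, ← sub_eq_zero, ← Finset.sum_sub_distrib,
    Finset.sum_congr rfl fun P hP => hs P hP, Finset.sum_comm]
  refine Finset.sum_eq_zero fun e _ => ?_
  rw [Finset.sum_sub_distrib, Finset.sum_ite_eq, Finset.sum_ite_eq,
    if_pos (Finset.mem_coe.1 (hsub.edge e).left_mem),
    if_pos (Finset.mem_coe.1 (hsub.edge e).right_mem), sub_self]

theorem RankGE.le_divDeg (hΓ : IsMetricGraph Γ) {D : Divisor Γ} {r : ℕ} (h : RankGE Γ D r) :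
    (r : ℤ) ≤ divDeg D := by
  have := hΓ.2.1
  obtain ⟨P⟩ : Nonempty Γ := inferInstance
  obtain ⟨D', hD', hlin⟩ := h (Finsupp.single P (r : ℤ)) (effective_single P (by positivity))
    (divDeg_single P _)
  have h1 := hlin.divDeg_eq hΓ
  have h2 := hD'.divDeg_nonneg
  rw [divDeg_sub, divDeg_single] at h1
  omega

theorem exists_rankGE_of_divRank_pos {D : Divisor Γ} (h : 0 < divRank Γ D) :
    ∃ r : ℕ, 1 ≤ r ∧ RankGE Γ D r := by
  rw [divRank] at h
  set A := insert (-1) {n : ℤ | ∃ r : ℕ, n = (r : ℤ) ∧ RankGE Γ D r} with hA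
  have hbdd : BddAbove A := by
    by_contra hb
    rw [Int.csSup_of_not_bddAbove hb] at h
    exact lt_irrefl _ h
  have hmem : sSup A ∈ A := Int.csSup_mem ⟨-1, Set.mem_insert _ _⟩ hbdd
  rcases hmem with h1 | ⟨r, hr, hrank⟩
  · omega
  · exact ⟨r, by omega, hrank⟩

namespace IsCanonical

variable {K : Divisor Γ}

theorem isVertex_iff (hK : IsCanonical Γ K) (P : Γ) : IsVertex Γ P ↔ P ∈ K.support := by
  rw [Finsupp.mem_support_iff, hK P, IsVertex]
  omega

/-- The degree of the canonical divisor in terms of a subdivision. -/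
theorem divDeg_eq (hK : IsCanonical Γ K) (hΓ : IsMetricGraph Γ) {S : Finset Γ}
    (hKS : K.support ⊆ S) {E : Type*} [Fintype E] {τ : E → ℝ → Γ} {ℓ : E → ℝ}
    (h : IsSubdivision (S : Set Γ) τ ℓ) : divDeg K = 2 * Fintype.card E - 2 * S.card := by
  classical
  rw [divDeg_eq_sum hKS, Finset.sum_congr rfl fun P hP =>
    (hK P).trans (by rw [h.valence_eq hΓ S.finite_toSet hP]), Finset.sum_sub_distrib,
    Finset.sum_comm]
  have : ∀ e ∈ Finset.univ, ∑ P ∈ S, ((if τ e 0 = P then (1 : ℤ) else 0) +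
      if τ e (ℓ e) = P then 1 else 0) = 2 := fun e _ => by
    rw [Finset.sum_add_distrib, Finset.sum_ite_eq, Finset.sum_ite_eq,
      if_pos (Finset.mem_coe.1 (h.edge e).left_mem),
      if_pos (Finset.mem_coe.1 (h.edge e).right_mem)]
    rfl
  rw [Finset.sum_congr rfl this]
  simp
  ring

theorem divDeg_le (hK : IsCanonical Γ K) (hΓ : IsMetricGraph Γ) :
    divDeg K ≤ 2 * graphGenus Γ - 2 := by
  classical
  obtain ⟨S, τ, ℓ, hKS, h⟩ := hΓ.exists_isSubdivision K.support
  have hfin := h.finite hΓ S.finite_toSet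
  have := Fintype.ofFinite (ConnectedComponents {x // x ∉ (S : Set Γ)})
  have hdeg := hK.divDeg_eq hΓ hKS h
  have hV : {P | IsVertex Γ P} = (K.support : Set Γ) := Set.ext hK.isVertex_iff
  have hunion : {P | IsVertex Γ P} ∪ ((S \ K.support : Finset Γ) : Set Γ) = S := by
    rw [hV, ← Finset.coe_union, Finset.union_sdiff_of_subset hKS]
  have hcomp := hΓ.card_components_union_le (T := {P | IsVertex Γ P})
    (hV ▸ K.support.finite_toSet) (S \ K.support) (fun P hP => by
      have := mt (hK.isVertex_iff P).1 (Finset.mem_sdiff.1 hP).2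
      exact not_not.1 this) (by rw [hunion]; exact hfin)
  rw [hunion, Finset.card_sdiff_of_subset hKS, Nat.card_eq_fintype_card] at hcomp
  have hcardV : Nat.card {P : Γ // IsVertex Γ P} = K.support.card := by
    rw [Nat.card_congr (Equiv.subtypeEquivRight hK.isVertex_iff), Nat.card_eq_fintype_card,
      Fintype.card_coe]
  have hle := Finset.card_le_card hKS
  have hgenus : graphGenus Γ =
      (Nat.card (ConnectedComponents {x // x ∉ {P | IsVertex Γ P}}) : ℤ) - K.support.card + 1 := by
    rw [graphGenus, hcardV]
    rfl
  omega

/-- If the canonical degree is positive, divisors of positive rank have degree at least two. -/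
theorem two_le_divDeg (hK : IsCanonical Γ K) (hΓ : IsMetricGraph Γ) (hpos : 0 < divDeg K)
    {D : Divisor Γ} (hD : 0 < divRank Γ D) : 2 ≤ divDeg D := by
  classical
  obtain ⟨r, hr, hrank⟩ := exists_rankGE_of_divRank_pos hD
  have hle := hrank.le_divDeg hΓ
  by_contra hlt
  obtain rfl : r = 1 := by omega
  have hdeg : divDeg D = 1 := by omega
  obtain ⟨S, τ, ℓ, hFS, h⟩ := hΓ.exists_isSubdivision (K.support ∪ D.support)
  have := h.finite hΓ S.finite_toSet
  have := Fintype.ofFinite (ConnectedComponents {x // x ∉ (S : Set Γ)})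
  have hKdeg := hK.divDeg_eq hΓ (Finset.subset_union_left.trans hFS) h
  have hDS : D.support ⊆ S := Finset.subset_union_right.trans hFS
  refine false_of_forall_vertex_equiv (V := S) (fun e => ⟨τ e 0, (h.edge e).left_mem⟩)
    (fun e => ⟨τ e (ℓ e), (h.edge e).right_mem⟩) ℓ (fun e => (h.edge e).pos)
    (fun e he => h.left_ne_right e (congrArg Subtype.val he))
    (by rw [Fintype.card_coe]; omega) (fun v => D v) fun P => ?_
  obtain ⟨D', hD', hlin⟩ := hrank (Finsupp.single (P : Γ) 1) (effective_single _ zero_le_one)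
    (divDeg_single _ _)
  have hD'0 : D' = 0 := hD'.eq_zero (by
    rw [← hlin.divDeg_eq hΓ, divDeg_sub, divDeg_single, hdeg, sub_self])
  subst hD'0
  obtain ⟨f, hf, hord⟩ := hlin
  have hord' : ∀ v, HasOrderAt Γ f v ((if (P : Γ) = v then 1 else 0) - D v) := fun v => by
    convert hord v using 1
    rw [Finsupp.sub_apply, Finsupp.single_apply, Finsupp.zero_apply]
    ring
  obtain ⟨s, hs, hs'⟩ := h.exists_slopes S.finite_toSet hf hord' fun v hv => by
    rw [Finsupp.notMem_support_iff.1 fun h => hv (hDS h), if_neg, sub_zero]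
    rintro rfl
    exact hv P.2
  refine ⟨fun v => f v, s, hs, fun v => ?_⟩
  simpa only [Subtype.ext_iff] using hs' v v.2

end IsCanonical

end Degree

/-- a very special divisor `D` on a metric graph of genus `g` satisfies
`2 ≤ deg(D) ≤ 2g - 4`; in particular a metric graph of genus `g ≤ 2` carries no very
special divisor (the genus must be at least `3`). -/
theorem statement16 (Γ : Type) [MetricSpace Γ] (hΓ : IsMetricGraph Γ)
    (g : ℤ) (hg : graphGenus Γ = g)
    (D : Divisor Γ) (hD : VerySpecial Γ D) :
    2 ≤ divDeg D ∧ divDeg D ≤ 2 * g - 4 ∧ 3 ≤ g := by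
  obtain ⟨-, hrank, K, hK, hrank'⟩ := hD
  obtain ⟨r, hr, hr1⟩ := exists_rankGE_of_divRank_pos hrank
  obtain ⟨r', hr', hr1'⟩ := exists_rankGE_of_divRank_pos hrank'
  have h1 := hr1.le_divDeg hΓ
  have h2 := hr1'.le_divDeg hΓ
  rw [divDeg_sub] at h2
  have hpos : 0 < divDeg K := by omega
  have h3 := hK.two_le_divDeg hΓ hpos hrank
  have h4 := hK.two_le_divDeg hΓ hpos hrank'
  rw [divDeg_sub] at h4
  have h5 := hK.divDeg_le hΓ
  omega
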